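/- arXiv:1903.07574 — 5 statements merged into one kernel-verified Lean document; each statement's English description precedes it below -/
import Mathlib

section
/- Let α > 1 and set r = 1 − 1/α. For every s ≥ 0, φ_α(s) = (1/π) ∫_0^{1/α} (x/(1−x))^{αx} sin(απx) e^{−sx} dx − Φ(α,s), where Φ(α,s) = (1/(2πi)) ∮_{|z+1|=r} exp(α z Log(1+1/z)) e^{sz} dz is the counterclockwise circle integral over the circle of center −1 and radius r (Log being the principal branch of the complex logarithm, whose value at the single circle point z = −1/α lying on the cut does not affect the integral). Moreover, s ↦ (1/π) ∫_0^{1/α} (x/(1−x))^{αx} sin(απx) e^{−sx} dx is completely monotonic on (0,∞). -/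
open MeasureTheory Filter Set Asymptotics

/-- The sequence of polynomials `p_n(α)` defined by `p_0(α) = 1` and
`p_{n+1}(α) = (α/(n+1)) · Σ_{k=0}^{n} ((k+1)/(k+2)) p_{n−k}(α)`. -/
noncomputable def bmpP {K : Type*} [Field K] (α : K) : ℕ → K
  | 0 => 1
  | n + 1 => (α / (n + 1)) * ∑ k ∈ Finset.range (n + 1), ((k + 1 : K) / (k + 2)) * bmpP α (n - k)
  decreasing_by exact Nat.lt_succ_of_le (Nat.sub_le n k)

/-- The real function `φ_α(s) = e^α Σ_{n≥0} (−1)^n p_{n+1}(α) s^n/n!` for real `α`. -/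
noncomputable def bmpPhiR (α s : ℝ) : ℝ :=
  Real.exp α * ∑' n : ℕ, (-1) ^ n * bmpP α (n + 1) * s ^ n / n.factorial

/-- A function `f : (0,∞) → ℝ` is completely monotonic. -/
def CompletelyMonotonicOn (f : ℝ → ℝ) : Prop :=
  ContDiffOn ℝ (⊤ : ℕ∞) f (Set.Ioi 0) ∧
    ∀ (n : ℕ), ∀ x ∈ Set.Ioi (0 : ℝ), 0 ≤ (-1 : ℝ) ^ n * iteratedDerivWithin n f (Set.Ioi 0) x

theorem bmpP_succ {K : Type*} [Field K] (α : K) (n : ℕ) :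
    bmpP α (n + 1) = (α / (n + 1)) *
      ∑ k ∈ Finset.range (n + 1), ((k + 1 : K) / (k + 2)) * bmpP α (n - k) := by
  rw [bmpP]

theorem abs_bmpP_le {α : ℝ} (hα : 0 ≤ α) (n : ℕ) : |bmpP α n| ≤ (1 + α) ^ n := by
  induction n using Nat.strong_induction_on with
  | _ n ih =>
    cases n with
    | zero => simp [bmpP]
    | succ n =>
      have hsum : |∑ k ∈ Finset.range (n + 1), ((k + 1 : ℝ) / (k + 2)) * bmpP α (n - k)|
          ≤ (n + 1) * (1 + α) ^ n := by
        refine (Finset.abs_sum_le_sum_abs _ _).trans ?_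
        calc _ ≤ ∑ k ∈ Finset.range (n + 1), (1 + α) ^ n := by
              refine Finset.sum_le_sum fun k _ => ?_
              have h1 : |((k + 1 : ℝ) / (k + 2))| ≤ 1 := by
                rw [abs_of_nonneg (by positivity), div_le_one (by positivity)]
                linarith
              have h2 : |bmpP α (n - k)| ≤ (1 + α) ^ n :=
                (ih (n - k) (by omega)).trans
                  (pow_le_pow_right₀ (by linarith) (Nat.sub_le n k))
              rw [abs_mul]
              simpa using mul_le_mul h1 h2 (abs_nonneg _) zero_le_one
          _ = (n + 1) * (1 + α) ^ n := by simp
      rw [bmpP_succ, abs_mul, abs_of_nonneg (by positivity : (0 : ℝ) ≤ α / (n + 1))]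
      calc _ ≤ α / (n + 1) * ((n + 1) * (1 + α) ^ n) := by gcongr
        _ = α * (1 + α) ^ n := by field_simp
        _ ≤ (1 + α) ^ (n + 1) := by
          rw [pow_succ']
          gcongr
          linarith

theorem summable_norm_mul_pow {a : ℕ → ℂ} {A : ℝ} (ha : ∀ n, ‖a n‖ ≤ A ^ n) (hA : 1 ≤ A)
    {u : ℂ} (hu : ‖u‖ < 1 / A) : Summable fun n => ‖a n * u ^ n‖ := by
  have hA0 : 0 < A := by linarith
  have h1 : A * ‖u‖ < 1 := by
    rwa [lt_div_iff₀ hA0, mul_comm] at hu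
  refine Summable.of_nonneg_of_le (fun _ => norm_nonneg _) (fun n => ?_)
    (summable_geometric_of_lt_one (by positivity) h1)
  rw [norm_mul, norm_pow, mul_pow]
  gcongr
  exact ha n

theorem hasDerivAt_tsum_mul_pow {a : ℕ → ℂ} {A : ℝ} (ha : ∀ n, ‖a n‖ ≤ A ^ n) (hA : 1 ≤ A)
    {u : ℂ} (hu : ‖u‖ < 1 / A) :
    HasDerivAt (fun u : ℂ => ∑' n, a n * u ^ n) (∑' n : ℕ, ((n : ℂ) + 1) * a (n + 1) * u ^ n) u := by
  have hA0 : 0 < A := by linarith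
  obtain ⟨ρ, hρ, hρA⟩ := exists_between hu
  have hρ0 : 0 ≤ ρ := (norm_nonneg u).trans hρ.le
  have h1 : A * ρ < 1 := by
    rwa [lt_div_iff₀ hA0, mul_comm] at hρA
  have hS : Summable fun n : ℕ => A * (((n : ℝ) ^ 1 * (A * ρ) ^ n) + (A * ρ) ^ n) :=
    ((summable_pow_mul_geometric_of_norm_lt_one 1
      (by rwa [Real.norm_of_nonneg (by positivity)])).add
        (summable_geometric_of_lt_one (by positivity) h1)).mul_left A
  have hS' : Summable fun n : ℕ => ‖a n‖ * (n * ρ ^ (n - 1)) := by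
    rw [← summable_nat_add_iff 1]
    refine Summable.of_nonneg_of_le (fun _ => by positivity) (fun n => ?_) hS
    calc ‖a (n + 1)‖ * (((n + 1 : ℕ) : ℝ) * ρ ^ (n + 1 - 1))
        ≤ A ^ (n + 1) * (((n + 1 : ℕ) : ℝ) * ρ ^ (n + 1 - 1)) := by
          gcongr
          exact ha _
      _ = _ := by
        simp only [Nat.add_sub_cancel]
        push_cast
        ring
  have key := hasDerivAt_tsum_of_isPreconnected (g := fun n (u : ℂ) => a n * u ^ n)
    (g' := fun n u => a n * (n * u ^ (n - 1))) (t := Metric.ball 0 ρ) (y₀ := 0) (y := u)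
    hS' Metric.isOpen_ball (convex_ball _ _).isPreconnected
    (fun n y _ => (hasDerivAt_pow n y).const_mul _)
    (fun n y hy => by
      rw [mem_ball_zero_iff] at hy
      rw [norm_mul, norm_mul, norm_pow, Complex.norm_natCast]
      gcongr)
    (Metric.mem_ball_self ((norm_nonneg u).trans_lt hρ))
    ((summable_norm_mul_pow ha hA (u := 0) (by simpa using hA0)).of_norm)
    (by simpa using hρ)
  refine key.congr_deriv ?_
  have hsum : Summable fun n : ℕ => a n * ((n : ℂ) * u ^ (n - 1)) := by
    refine Summable.of_norm_bounded hS' fun n => ?_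
    rw [norm_mul, norm_mul, norm_pow, Complex.norm_natCast]
    gcongr
  rw [hsum.tsum_eq_zero_add]
  simp only [Nat.cast_zero, zero_mul, mul_zero, zero_add, Nat.add_sub_cancel]
  refine tsum_congr fun n => ?_
  push_cast
  ring

theorem tsum_bmpP_mul_pow {α : ℝ} (hα : 0 ≤ α) {u : ℂ} (hu : ‖u‖ < 1 / (1 + α)) :
    ∑' n, ((bmpP α n : ℝ) : ℂ) * u ^ n
      = Complex.exp (-α) * Complex.exp (α * ∑' n : ℕ, ((1 : ℂ) / (n + 1)) * u ^ n) := by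
  set a : ℕ → ℂ := fun n => ((bmpP α n : ℝ) : ℂ) with ha_def
  set b : ℕ → ℂ := fun n => (1 : ℂ) / (n + 1) with hb_def
  have hA : 1 ≤ 1 + α := by linarith
  have ha : ∀ n, ‖a n‖ ≤ (1 + α) ^ n := fun n => by
    simpa [ha_def, Complex.norm_real] using abs_bmpP_le hα n
  have hb1 : ∀ n : ℕ, ‖((n : ℂ) + 1)‖ = n + 1 := fun n => by
    rw [← Nat.cast_one, ← Nat.cast_add, Complex.norm_natCast]
    push_cast
    rfl
  have hb : ∀ n, ‖b n‖ ≤ (1 + α) ^ n := fun n => by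
    refine le_trans ?_ (one_le_pow₀ hA)
    rw [hb_def]
    simp only [norm_div, norm_one, hb1]
    rw [div_le_one (by positivity)]
    linarith [(Nat.cast_nonneg n : (0 : ℝ) ≤ n)]
  set M : ℕ → ℂ := fun n => ((n : ℂ) + 1) / (n + 2) with hM_def
  have hM : ∀ n, ‖M n‖ ≤ (1 + α) ^ n := fun n => by
    refine le_trans ?_ (one_le_pow₀ hA)
    have h2 : ‖((n : ℂ) + 2)‖ = n + 2 := by
      have := hb1 (n + 1)
      push_cast at this
      rw [add_assoc, add_assoc, one_add_one_eq_two, one_add_one_eq_two] at this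
      exact this
    rw [hM_def]
    simp only [norm_div, hb1, h2]
    rw [div_le_one (by positivity)]
    linarith
  have hderivP : ∀ v : ℂ, ‖v‖ < 1 / (1 + α) → HasDerivAt (fun u : ℂ => ∑' n, a n * u ^ n)
      (α * ((∑' n, M n * v ^ n) * ∑' n, a n * v ^ n)) v := fun v hv => by
    refine (hasDerivAt_tsum_mul_pow ha hA hv).congr_deriv ?_
    rw [tsum_mul_tsum_eq_tsum_sum_range_of_summable_norm (summable_norm_mul_pow hM hA hv)
      (summable_norm_mul_pow ha hA hv), ← tsum_mul_left]
    refine tsum_congr fun n => ?_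
    have hn : ((n : ℂ) + 1) ≠ 0 := Nat.cast_add_one_ne_zero n
    have : a (n + 1) = (α / (n + 1)) * ∑ k ∈ Finset.range (n + 1), M k * a (n - k) := by
      simp only [ha_def, hM_def]
      rw [bmpP_succ]
      push_cast
      rfl
    rw [this, ← mul_assoc, mul_div_cancel₀ _ hn, mul_assoc, Finset.sum_mul]
    congr 1
    refine Finset.sum_congr rfl fun k hk => ?_
    have : v ^ n = v ^ k * v ^ (n - k) := by
      rw [← pow_add, Nat.add_sub_of_le (Nat.lt_succ_iff.mp (Finset.mem_range.mp hk))]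
    rw [this]
    ring
  have hderivL : ∀ v : ℂ, ‖v‖ < 1 / (1 + α) → HasDerivAt (fun u : ℂ => ∑' n, b n * u ^ n)
      (∑' n, M n * v ^ n) v := fun v hv => by
    convert hasDerivAt_tsum_mul_pow hb hA hv using 1
    refine tsum_congr fun n => ?_
    simp only [hb_def, hM_def]
    push_cast
    ring
  have hconst : ∀ v ∈ Metric.ball (0 : ℂ) (1 / (1 + α)), HasDerivAt
      (fun u : ℂ => (∑' n, a n * u ^ n) * Complex.exp (-(α * ∑' n, b n * u ^ n))) 0 v := by
    intro v hv
    rw [mem_ball_zero_iff] at hv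
    refine ((hderivP v hv).mul ((hderivL v hv).const_mul (α : ℂ)).neg.cexp).congr_deriv ?_
    ring
  have hc := IsOpen.is_const_of_deriv_eq_zero Metric.isOpen_ball
    (convex_ball (0 : ℂ) (1 / (1 + α))).isPreconnected
    (fun v hv => (hconst v hv).differentiableAt.differentiableWithinAt)
    (fun v hv => (hconst v hv).deriv)
    (mem_ball_zero_iff.mpr hu) (Metric.mem_ball_self (by positivity : (0 : ℝ) < 1 / (1 + α)))
  have h0 : ∀ c : ℕ → ℂ, ∑' n, c n * (0 : ℂ) ^ n = c 0 := fun c => by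
    rw [tsum_eq_single 0 (fun n hn => by simp [hn])]
    simp
  simp only [h0] at hc
  have ha0 : a 0 = 1 := by simp [ha_def, bmpP]
  have hb0 : b 0 = 1 := by simp [hb_def]
  rw [ha0, hb0, one_mul, mul_one, Complex.exp_neg, mul_inv_eq_iff_eq_mul₀ (Complex.exp_ne_zero _)] at hc
  exact hc

theorem exp_mul_log_one_add_inv {α : ℝ} (hα : 0 ≤ α) {z : ℂ} (hz : 1 + α < ‖z‖) :
    Complex.exp (α * z * Complex.log (1 + 1 / z))
      = Complex.exp α * ∑' n, ((bmpP α n : ℝ) : ℂ) * (-(1 / z)) ^ n := by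
  have hz0 : z ≠ 0 := norm_pos_iff.mp (by linarith)
  have hu1 : ‖-(1 / z)‖ < 1 / (1 + α) := by
    rw [norm_neg, norm_div, norm_one]
    exact one_div_lt_one_div_of_lt (by linarith) hz
  have hu2 : ‖-(1 / z)‖ < 1 :=
    hu1.trans_le ((div_le_one (by linarith)).mpr (by linarith))
  have hlog := Complex.hasSum_taylorSeries_neg_log hu2
  have h1 := hlog.tsum_eq
  rw [hlog.summable.tsum_eq_zero_add] at h1
  simp only [Nat.cast_zero, div_zero, zero_add] at h1
  have h2 : ∑' n : ℕ, ((1 : ℂ) / (n + 1)) * (-(1 / z)) ^ n = z * Complex.log (1 + 1 / z) := by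
    rw [show 1 + 1 / z = 1 - -(1 / z) by ring, ← neg_neg (Complex.log _), ← h1, mul_neg,
      ← neg_mul, ← tsum_mul_left]
    refine tsum_congr fun n => ?_
    push_cast
    rw [pow_succ]
    field_simp
  rw [tsum_bmpP_mul_pow hα hu1, ← mul_assoc, ← Complex.exp_add, add_neg_cancel, Complex.exp_zero,
    one_mul, h2, mul_assoc]

theorem circleIntegral_inv_pow_mul_exp {s ρ : ℝ} {c : ℂ} (hρ : (0 : ℂ) ∈ Metric.ball c ρ) (n : ℕ) :
    (∮ z in C(c, ρ), (z⁻¹) ^ (n + 1) * Complex.exp (s * z))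
      = 2 * Real.pi * Complex.I * (s ^ n / n.factorial) := by
  have hρ0 : 0 < ρ := Metric.pos_of_mem_ball hρ
  have hne : ∀ z ∈ Metric.sphere c ρ, z ≠ 0 := by
    rintro z hz rfl
    exact absurd (Metric.mem_sphere.mp hz) (Metric.mem_ball.mp hρ).ne
  have hcont : ∀ m : ℕ, CircleIntegrable (fun z => (z⁻¹) ^ m * Complex.exp (s * z)) c ρ := fun m =>
    ContinuousOn.circleIntegrable hρ0.le
      (((continuousOn_id.inv₀ hne).pow m).mul (by fun_prop))
  induction n with
  | zero =>
    have hd : DiffContOnCl ℂ (fun z : ℂ => Complex.exp (s * z)) (Metric.ball c ρ) :=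
      Differentiable.diffContOnCl (by fun_prop)
    simpa using hd.circleIntegral_sub_inv_smul hρ
  | succ n ih =>
    have hz := circleIntegral.integral_eq_zero_of_hasDerivWithinAt (c := c) hρ0.le
      (f := fun z => (z⁻¹) ^ (n + 1) * Complex.exp (s * z))
      (f' := fun z => s * ((z⁻¹) ^ (n + 1) * Complex.exp (s * z))
        - ((n : ℂ) + 1) * ((z⁻¹) ^ (n + 1 + 1) * Complex.exp (s * z)))
      (fun z hz => by
        have hz0 := hne z hz
        refine HasDerivAt.hasDerivWithinAt ?_
        refine (((hasDerivAt_inv hz0).pow (n + 1)).mul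
          (((hasDerivAt_id z).const_mul (s : ℂ)).cexp)).congr_deriv ?_
        simp only [id, Nat.add_sub_cancel, Pi.pow_apply]
        push_cast
        rw [← inv_pow]
        ring)
    have hsub := circleIntegral.integral_sub ((hcont (n + 1)).const_smul (a := (s : ℂ)))
      ((hcont (n + 1 + 1)).const_smul (a := (n : ℂ) + 1))
    simp only [Pi.smul_apply, smul_eq_mul] at hsub
    rw [hsub, circleIntegral.integral_const_mul,
      circleIntegral.integral_const_mul, ih, sub_eq_zero] at hz
    have hn : ((n : ℂ) + 1) ≠ 0 := Nat.cast_add_one_ne_zero n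
    have hf : (n.factorial : ℂ) ≠ 0 := Nat.cast_ne_zero.mpr n.factorial_ne_zero
    apply mul_left_cancel₀ hn
    rw [← hz, Nat.factorial_succ]
    push_cast
    field_simp
    ring

theorem hasSum_bmpPhiR {α : ℝ} (hα : 0 ≤ α) (s : ℝ) :
    HasSum (fun n : ℕ => Real.exp α * ((-1) ^ n * bmpP α (n + 1) * s ^ n / n.factorial))
      (bmpPhiR α s) := by
  refine (Summable.hasSum ?_).mul_left _
  refine Summable.of_norm_bounded
    ((Real.summable_pow_div_factorial ((1 + α) * |s|)).mul_left (1 + α)) fun n => ?_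
  simp only [norm_div, norm_mul, norm_pow, norm_neg, norm_one, one_pow, one_mul, Real.norm_eq_abs,
    Nat.abs_cast]
  calc _ ≤ (1 + α) ^ (n + 1) * |s| ^ n / n.factorial := by
        gcongr
        exact abs_bmpP_le hα _
    _ = _ := by
        rw [mul_pow, pow_succ]
        ring

theorem circleIntegral_exp_mul_log_eq_bmpPhiR {α : ℝ} (hα : 0 < α) (s : ℝ) {ρ : ℝ}
    (hρ : 2 * (1 + α) + 1 ≤ ρ) :
    (∮ z in C(-1, ρ), Complex.exp ((α : ℂ) * z * Complex.log (1 + 1 / z)) * Complex.exp ((s : ℂ) * z))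
      = -(2 * Real.pi * Complex.I * bmpPhiR α s) := by
  have hρ0 : 0 ≤ ρ := by linarith
  have hz : ∀ z ∈ Metric.sphere (-1 : ℂ) ρ, 2 * (1 + α) ≤ ‖z‖ := fun z hz => by
    have h1 : ‖z - -1‖ = ρ := mem_sphere_iff_norm.mp hz
    have h2 := norm_sub_le z (-1)
    rw [h1, norm_neg, norm_one] at h2
    linarith
  have hne : ∀ z ∈ Metric.sphere (-1 : ℂ) ρ, z ≠ 0 := fun z h =>
    norm_pos_iff.mp (by linarith [hz z h])
  set f : ℕ → ℂ → ℂ := fun n z => Complex.exp α * ((-1) ^ n * ((bmpP α n : ℝ) : ℂ)) *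
    ((z⁻¹) ^ n * Complex.exp (s * z)) with hf
  have hfc : ∀ n, ContinuousOn (f n) (Metric.sphere (-1 : ℂ) ρ) := fun n =>
    continuousOn_const.mul (((continuousOn_id.inv₀ hne).pow n).mul (by fun_prop))
  obtain ⟨B, hB⟩ := (isCompact_sphere (-1 : ℂ) ρ).exists_bound_of_continuousOn
    (f := fun z => Complex.exp α * Complex.exp (s * z)) (by fun_prop)
  have hbound : ∀ n, ∀ z ∈ Metric.sphere (-1 : ℂ) ρ, ‖f n z‖ ≤ (1 / 2) ^ n * B := by
    intro n z hzs
    have h1 : ‖((bmpP α n : ℝ) : ℂ)‖ * ‖z⁻¹‖ ^ n ≤ (1 / 2) ^ n := by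
      rw [Complex.norm_real, Real.norm_eq_abs, norm_inv]
      calc _ ≤ (1 + α) ^ n * ((2 * (1 + α))⁻¹) ^ n := by
            gcongr
            · exact abs_bmpP_le hα.le n
            · exact hz z hzs
        _ = _ := by
            rw [← mul_pow]
            congr 1
            field_simp
    calc ‖f n z‖ = ‖((bmpP α n : ℝ) : ℂ)‖ * ‖z⁻¹‖ ^ n * ‖Complex.exp α * Complex.exp (s * z)‖ := by
          simp only [hf, norm_mul, norm_pow, norm_neg, norm_one, one_pow]
          ring
      _ ≤ _ := by
          gcongr
          exact hB z hzs
  have hunif := tendstoUniformlyOn_tsum_nat (summable_geometric_two.mul_right B) hbound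
  have hlim := hunif.tendsto_circleIntegral_of_continuousOn hρ0
    (Eventually.of_forall fun N => continuousOn_finsetSum _ fun n _ => hfc n)
  have hval : ∀ N, (∮ z in C(-1, ρ), ∑ n ∈ Finset.range N, f n z)
      = ∑ n ∈ Finset.range N, ∮ z in C(-1, ρ), f n z := fun N =>
    circleIntegral.integral_fun_sum fun n _ => (hfc n).circleIntegrable hρ0
  have hJ0 : (∮ z in C(-1, ρ), f 0 z) = 0 := by
    refine DiffContOnCl.circleIntegral_eq_zero hρ0 (Differentiable.diffContOnCl ?_)
    simp only [hf, pow_zero]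
    fun_prop
  have hJ : ∀ n, (∮ z in C(-1, ρ), f (n + 1) z) = -(2 * Real.pi * Complex.I) *
      ((Real.exp α * ((-1) ^ n * bmpP α (n + 1) * s ^ n / n.factorial) : ℝ) : ℂ) := fun n => by
    simp only [hf]
    rw [circleIntegral.integral_const_mul, circleIntegral_inv_pow_mul_exp
      (by simpa using (by linarith : 1 < ρ))]
    push_cast
    ring
  have h1 := ((Complex.hasSum_ofReal.mpr (hasSum_bmpPhiR hα.le s)).mul_left
    (-(2 * Real.pi * Complex.I))).tendsto_sum_nat
  have h2 := (tendsto_add_atTop_iff_nat 1).mpr hlim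
  simp only [hval] at h2
  simp only [Finset.sum_range_succ', hJ0, hJ, add_zero] at h2
  have h3 := tendsto_nhds_unique h2 h1
  rw [← neg_mul, ← h3]
  refine circleIntegral.integral_congr hρ0 fun z hzs => ?_
  rw [exp_mul_log_one_add_inv hα.le (by linarith [hz z hzs]), ← tsum_mul_left, ← tsum_mul_right]
  refine tsum_congr fun n => ?_
  simp only [hf]
  rw [neg_pow, one_div]
  ring

theorem Complex.continuousWithinAt_log_upperHalfPlane {z : ℂ} (hz0 : z ≠ 0) :
    ContinuousWithinAt Complex.log {z | 0 ≤ z.im} z := by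
  by_cases h : z ∈ Complex.slitPlane
  · exact (continuousAt_clog h).continuousWithinAt
  · rw [Complex.mem_slitPlane_iff, not_or, not_lt, not_not] at h
    refine Complex.continuousWithinAt_log_of_re_neg_of_im_zero (lt_of_le_of_ne h.1 fun h0 => ?_) h.2
    exact hz0 (Complex.ext h0 h.2)

theorem Complex.continuousAt_mul_log_zero : ContinuousAt (fun z : ℂ => z * Complex.log z) 0 := by
  rw [ContinuousAt, zero_mul]
  have h1 : Tendsto (fun z : ℂ => |‖z‖ * Real.log ‖z‖| + ‖z‖ * Real.pi) (nhds 0) (nhds 0) := by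
    have : Continuous fun z : ℂ => |‖z‖ * Real.log ‖z‖| + ‖z‖ * Real.pi :=
      (Real.continuous_mul_log.comp continuous_norm).abs.add (continuous_norm.mul continuous_const)
    simpa using this.tendsto 0
  refine squeeze_zero_norm (fun z => ?_) h1
  rw [norm_mul, abs_mul, abs_norm, ← mul_add]
  gcongr
  refine (Complex.norm_le_abs_re_add_abs_im _).trans ?_
  rw [Complex.log_re, Complex.log_im]
  gcongr
  exact Complex.abs_arg_le_pi z

theorem Complex.log_ofReal_of_neg {x : ℝ} (hx : x < 0) :
    Complex.log x = Real.log x + Real.pi * Complex.I := by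
  apply Complex.ext
  · simp [Complex.log_ofReal_re]
  · simp [Complex.log_im, Complex.arg_ofReal_of_neg hx]

/-- The boundary extension to the closed upper half-plane of `z ↦ exp (α z Log (1 + 1/z)) e^{sz}`. -/
noncomputable def bmpUpper (α s : ℝ) (z : ℂ) : ℂ :=
  Complex.exp (α * (z * Complex.log (z + 1) - z * Complex.log z)) * Complex.exp (s * z)

theorem continuousOn_bmpUpper (α s : ℝ) :
    ContinuousOn (bmpUpper α s) ({z | 0 ≤ z.im} \ {-1}) := by
  rintro z ⟨-, hz1⟩
  have hz1' : z + 1 ≠ 0 := fun h => hz1 (eq_neg_of_add_eq_zero_left h)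
  have h1 : ContinuousWithinAt (fun w : ℂ => Complex.log (w + 1)) {z | 0 ≤ z.im} z :=
    (Complex.continuousWithinAt_log_upperHalfPlane hz1').comp_of_eq (f := fun w : ℂ => w + 1)
      (Continuous.continuousWithinAt (by fun_prop))
      (fun w (hw : 0 ≤ w.im) => by simpa using hw) rfl
  have h2 : ContinuousWithinAt (fun w : ℂ => w * Complex.log w) {z | 0 ≤ z.im} z := by
    by_cases h0 : z = 0
    · subst h0
      exact Complex.continuousAt_mul_log_zero.continuousWithinAt
    · exact continuousWithinAt_id.mul (Complex.continuousWithinAt_log_upperHalfPlane h0)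
  have h3 : ContinuousWithinAt (bmpUpper α s) {z | 0 ≤ z.im} z :=
    (((continuousWithinAt_id.mul h1).sub h2).const_mul (α : ℂ)).cexp.mul
      (Continuous.continuousWithinAt (by fun_prop))
  exact h3.mono sdiff_subset

theorem differentiableAt_bmpUpper (α s : ℝ) {z : ℂ} (hz : 0 < z.im) :
    DifferentiableAt ℂ (bmpUpper α s) z := by
  have h1 : z ∈ Complex.slitPlane := Or.inr hz.ne'
  have h2 : z + 1 ∈ Complex.slitPlane := Or.inr (by simpa using hz.ne')
  unfold bmpUpper
  exact (((differentiableAt_id.mul ((differentiableAt_id.add_const 1).clog h2)).sub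
    (differentiableAt_id.mul (differentiableAt_id.clog h1))).const_mul _).cexp.mul (by fun_prop)

theorem bmpUpper_eq (α s : ℝ) {z : ℂ} (hz : 0 < z.im) :
    bmpUpper α s z = Complex.exp ((α : ℂ) * z * Complex.log (1 + 1 / z)) * Complex.exp (s * z) := by
  have hz0 : z ≠ 0 := by
    rintro rfl
    simp at hz
  have hz1 : z + 1 ≠ 0 := fun h => by
    rw [eq_neg_of_add_eq_zero_left h] at hz
    simp at hz
  have hz' : 0 < (z + 1).im := by simpa using hz
  have hlog : Complex.log (1 + 1 / z) = Complex.log (z + 1) - Complex.log z := by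
    have a1 := Complex.arg_nonneg_iff.mpr hz.le
    have a2 := Complex.arg_nonneg_iff.mpr hz'.le
    have b1 := Complex.arg_lt_pi_iff.mpr (Or.inr hz.ne')
    have b2 := Complex.arg_lt_pi_iff.mpr (Or.inr hz'.ne')
    rw [← Complex.log_exp (x := Complex.log (z + 1) - Complex.log z), Complex.exp_sub,
      Complex.exp_log hz1, Complex.exp_log hz0, add_div, div_self hz0]
    · rw [Complex.sub_im, Complex.log_im, Complex.log_im]
      linarith
    · rw [Complex.sub_im, Complex.log_im, Complex.log_im]
      linarith
  rw [bmpUpper, hlog]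
  congr 2
  ring

theorem bmpUpper_ofReal_im_eq_zero (α s : ℝ) {x : ℝ} (hx : 0 ≤ x ∨ x < -1) :
    (bmpUpper α s x).im = 0 := by
  have key : (x : ℂ) * Complex.log (x + 1) - x * Complex.log x
      = ((x * Real.log (x + 1) - x * Real.log x : ℝ) : ℂ) := by
    rcases hx with hx | hx
    · push_cast
      rw [Complex.ofReal_log hx, Complex.ofReal_log (by linarith)]
      push_cast
      rfl
    · rw [show (x : ℂ) + 1 = ((x + 1 : ℝ) : ℂ) by push_cast; rfl,
        Complex.log_ofReal_of_neg (by linarith), Complex.log_ofReal_of_neg (by linarith)]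
      push_cast
      ring
  rw [bmpUpper, key, ← Complex.ofReal_mul, ← Complex.ofReal_mul, ← Complex.ofReal_exp,
    ← Complex.ofReal_exp, ← Complex.ofReal_mul, Complex.ofReal_im]

theorem bmpUpper_neg_ofReal_im (α s : ℝ) {x : ℝ} (hx0 : 0 < x) (hx1 : x < 1) :
    (bmpUpper α s (-x)).im
      = (x / (1 - x)) ^ (α * x) * Real.sin (α * Real.pi * x) * Real.exp (-s * x) := by
  have h1 : Complex.log (-(x : ℂ) + 1) = (Real.log (1 - x) : ℝ) := by
    rw [Complex.ofReal_log (by linarith)]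
    push_cast
    ring_nf
  have h2 : Complex.log (-(x : ℂ)) = Real.log x + Real.pi * Complex.I := by
    rw [← Complex.ofReal_neg, Complex.log_ofReal_of_neg (by linarith), Real.log_neg_eq_log]
  have h3 : bmpUpper α s (-x) = ((Real.exp (α * x * (Real.log x - Real.log (1 - x)))
      * Real.exp (-s * x) : ℝ) : ℂ) * Complex.exp ((α * Real.pi * x : ℝ) * Complex.I) := by
    rw [bmpUpper, h1, h2]
    push_cast
    rw [← Complex.exp_add, ← Complex.exp_add, ← Complex.exp_add]
    congr 1
    ring
  rw [h3, Complex.im_ofReal_mul, Complex.exp_ofReal_mul_I_im,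
    Real.rpow_def_of_pos (by apply div_pos <;> linarith), Real.log_div (by linarith) (by linarith)]
  rw [show α * x * (Real.log x - Real.log (1 - x)) = (Real.log x - Real.log (1 - x)) * (α * x) by
    ring]
  ring

/-- The integral of `bmpUpper` over the upper half of the circle of center `-1` and radius `ρ`,
divided by `I`. -/
noncomputable def bmpHalf (α s ρ : ℝ) : ℂ :=
  ∫ θ in (0 : ℝ)..Real.pi, circleMap 0 ρ θ * bmpUpper α s (circleMap (-1) ρ θ)

theorem circleMap_neg_one_eq (ρ θ : ℝ) : circleMap (-1) ρ θ
    = ((-1 + ρ * Real.cos θ : ℝ) : ℂ) + ((ρ * Real.sin θ : ℝ) : ℂ) * Complex.I := by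
  rw [circleMap, Complex.exp_mul_I]
  push_cast
  ring

theorem continuousOn_bmpHalf_integrand (α s : ℝ) {ρ : ℝ} (hρ : 0 < ρ) :
    ContinuousOn (fun θ : ℝ => circleMap 0 ρ θ * bmpUpper α s (circleMap (-1) ρ θ))
      (Icc 0 Real.pi) := by
  refine (continuous_circleMap 0 ρ).continuousOn.mul
    ((continuousOn_bmpUpper α s).comp (continuous_circleMap (-1) ρ).continuousOn fun θ hθ => ⟨?_, ?_⟩)
  · have : 0 ≤ ρ * Real.sin θ := mul_nonneg hρ.le (Real.sin_nonneg_of_mem_Icc hθ)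
    simpa [circleMap_neg_one_eq, -Complex.ofReal_mul] using this
  · exact circleMap_ne_center (c := -1) (θ := θ) hρ.ne'

theorem circleIntegral_eq_bmpHalf (α s : ℝ) {ρ : ℝ} (hρ : 0 < ρ) :
    (∮ z in C(-1, ρ), Complex.exp ((α : ℂ) * z * Complex.log (1 + 1 / z)) * Complex.exp ((s : ℂ) * z))
      = 2 * Complex.I * (bmpHalf α s ρ).re := by
  set F : ℂ → ℂ := fun z =>
    Complex.exp ((α : ℂ) * z * Complex.log (1 + 1 / z)) * Complex.exp ((s : ℂ) * z) with hF
  set k : ℝ → ℂ := fun θ => circleMap 0 ρ θ * bmpUpper α s (circleMap (-1) ρ θ) with hk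
  set G : ℝ → ℂ := fun θ => deriv (circleMap (-1) ρ) θ • F (circleMap (-1) ρ θ) with hG
  have him : ∀ θ ∈ Ioo 0 Real.pi, 0 < (circleMap (-1) ρ θ).im := fun θ hθ => by
    have : 0 < ρ * Real.sin θ := mul_pos hρ (Real.sin_pos_of_mem_Ioo hθ)
    simpa [circleMap_neg_one_eq, -Complex.ofReal_mul] using this
  have hup : ∀ θ ∈ Ioo 0 Real.pi, G θ = Complex.I * k θ := fun θ hθ => by
    simp only [hG, hk, hF]
    rw [bmpUpper_eq α s (him θ hθ), deriv_circleMap, smul_eq_mul]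
    ring
  have hconjF : ∀ z : ℂ, 0 < z.im → F ((starRingEnd ℂ) z) = (starRingEnd ℂ) (F z) := by
    intro z hz
    have harg : (1 + 1 / z).arg ≠ Real.pi := fun h => by
      have h2 := (Complex.arg_eq_pi_iff.mp h).2
      have hz0 : z ≠ 0 := by
        rintro rfl
        simp at hz
      rw [one_div, Complex.add_im, Complex.one_im, zero_add, Complex.inv_im, div_eq_zero_iff] at h2
      rcases h2 with h2 | h2
      · linarith
      · exact hz0 (Complex.normSq_eq_zero.mp h2)
    simp only [hF, map_mul, ← Complex.exp_conj, ← Complex.log_conj _ harg, Complex.conj_ofReal,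
      map_add, map_one, map_div₀]
  have hconjc : ∀ (c : ℝ) (θ : ℝ),
      circleMap c ρ (2 * Real.pi - θ) = (starRingEnd ℂ) (circleMap c ρ θ) := by
    intro c θ
    rw [circleMap, circleMap, map_add, map_mul, Complex.conj_ofReal, Complex.conj_ofReal,
      ← Complex.exp_conj, map_mul, Complex.conj_ofReal, Complex.conj_I]
    push_cast
    rw [sub_mul, Complex.exp_sub, Complex.exp_two_pi_mul_I, mul_neg, Complex.exp_neg, one_div]
  have hlow : ∀ θ ∈ Ioo 0 Real.pi,
      G (2 * Real.pi - θ) = Complex.I * (starRingEnd ℂ) (k θ) := fun θ hθ => by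
    have e1 := hconjc (-1) θ
    have e0 := hconjc 0 θ
    push_cast at e1 e0
    simp only [hG]
    rw [deriv_circleMap, e1, e0, hconjF _ (him θ hθ), smul_eq_mul, hk]
    simp only [map_mul]
    rw [bmpUpper_eq α s (him θ hθ)]
    simp only [hF, map_mul]
    ring
  have hkint : IntervalIntegrable k volume 0 Real.pi :=
    (by simpa [uIcc_of_le Real.pi_pos.le] using continuousOn_bmpHalf_integrand α s hρ :
      ContinuousOn k (uIcc 0 Real.pi)).intervalIntegrable
  have hkint' : IntervalIntegrable (fun θ => (starRingEnd ℂ) (k θ)) volume 0 Real.pi := by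
    refine ContinuousOn.intervalIntegrable ?_
    rw [uIcc_of_le Real.pi_pos.le]
    exact Complex.continuous_conj.comp_continuousOn (continuousOn_bmpHalf_integrand α s hρ)
  have hae : ∀ᵐ θ : ℝ, θ ≠ Real.pi := by
    simp [ae_iff, measure_singleton]
  have hI1 : ∀ᵐ θ : ℝ, θ ∈ Set.uIoc 0 Real.pi → Complex.I * k θ = G θ := by
    filter_upwards [hae] with θ h1 h2
    rw [uIoc_of_le Real.pi_pos.le] at h2
    exact (hup θ ⟨h2.1, lt_of_le_of_ne h2.2 h1⟩).symm
  have hI2 : ∀ᵐ θ : ℝ, θ ∈ Set.uIoc 0 Real.pi →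
      Complex.I * (starRingEnd ℂ) (k θ) = G (2 * Real.pi - θ) := by
    filter_upwards [hae] with θ h1 h2
    rw [uIoc_of_le Real.pi_pos.le] at h2
    exact (hlow θ ⟨h2.1, lt_of_le_of_ne h2.2 h1⟩).symm
  have hG1 : IntervalIntegrable G volume 0 Real.pi :=
    (hkint.const_mul Complex.I).congr_ae ((ae_restrict_iff' measurableSet_uIoc).mpr hI1)
  have hG2' : IntervalIntegrable (fun θ => G (2 * Real.pi - θ)) volume 0 Real.pi :=
    (hkint'.const_mul Complex.I).congr_ae ((ae_restrict_iff' measurableSet_uIoc).mpr hI2)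
  have hG2 : IntervalIntegrable G volume Real.pi (2 * Real.pi) := by
    have := hG2'.comp_sub_left (2 * Real.pi)
    simp only [sub_sub_cancel, sub_zero] at this
    rw [show 2 * Real.pi - Real.pi = Real.pi by ring] at this
    exact this.symm
  have hv1 : ∫ θ in (0 : ℝ)..Real.pi, G θ = Complex.I * bmpHalf α s ρ := by
    rw [bmpHalf, ← intervalIntegral.integral_const_mul]
    refine (intervalIntegral.integral_congr_ae ?_).symm
    exact hI1
  have hv2 : ∫ θ in Real.pi..(2 * Real.pi), G θ
      = Complex.I * (starRingEnd ℂ) (bmpHalf α s ρ) := by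
    have h1 : ∫ θ in (0 : ℝ)..Real.pi, G (2 * Real.pi - θ) = ∫ θ in Real.pi..(2 * Real.pi), G θ := by
      rw [intervalIntegral.integral_comp_sub_left]
      congr 1 <;> ring
    rw [← h1, ← intervalIntegral.integral_congr_ae hI2, intervalIntegral.integral_const_mul, bmpHalf]
    congr 1
    exact intervalIntegral.intervalIntegral_conj
  change ∫ θ in (0 : ℝ)..(2 * Real.pi), G θ = _
  rw [← intervalIntegral.integral_add_adjacent_intervals hG1 hG2, hv1, hv2, ← mul_add,
    Complex.add_conj]
  push_cast
  ring

theorem continuousOn_bmpUpper_neg_im {α : ℝ} (hα : 1 < α) (s : ℝ) :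
    ContinuousOn (fun x : ℝ => (bmpUpper α s (-x)).im) (Icc 0 (1 / α)) := by
  refine Complex.continuous_im.comp_continuousOn
    ((continuousOn_bmpUpper α s).comp (by fun_prop) fun x hx => ⟨by simp, fun h => ?_⟩)
  have h1 : (x : ℂ) = 1 := neg_injective h
  have h2 : 1 / α < 1 := (div_lt_one (by linarith)).mpr hα
  have h3 : x = 1 := by exact_mod_cast h1
  linarith [hx.2]

theorem integrableOn_bmp_density {α : ℝ} (hα : 1 < α) (s : ℝ) :
    IntegrableOn
      (fun x : ℝ => (x / (1 - x)) ^ (α * x) * Real.sin (α * Real.pi * x) * Real.exp (-s * x))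
      (Ioo 0 (1 / α)) := by
  refine (((continuousOn_bmpUpper_neg_im hα s).integrableOn_Icc).mono_set
    Ioo_subset_Icc_self).congr_fun (fun x hx => ?_) measurableSet_Ioo
  exact bmpUpper_neg_ofReal_im α s hx.1 (hx.2.trans ((div_lt_one (by linarith)).mpr hα))

theorem re_bmpHalf_sub_re_bmpHalf {α : ℝ} (hα : 1 < α) (s : ℝ) {ρ : ℝ} (hρ : 1 < ρ) :
    (bmpHalf α s (1 - 1 / α)).re - (bmpHalf α s ρ).re = ∫ x in Ioo 0 (1 / α),
      (x / (1 - x)) ^ (α * x) * Real.sin (α * Real.pi * x) * Real.exp (-s * x) := by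
  have hα1 : 1 / α < 1 := (div_lt_one (by linarith)).mpr hα
  have hα0 : 0 < 1 / α := one_div_pos.mpr (by linarith)
  set r := 1 - 1 / α with hr
  have hr0 : 0 < r := by linarith
  have hr1 : r < 1 := by linarith
  have hlogr : Real.log r < 0 := Real.log_neg hr0 hr1
  have hlogρ : 0 < Real.log ρ := Real.log_pos hρ
  set g : ℂ → ℂ := fun w => Complex.exp w * bmpUpper α s (-1 + Complex.exp w) with hg
  have hexpim : ∀ w : ℂ, (-1 + Complex.exp w).im = Real.exp w.re * Real.sin w.im := fun w => by
    simp [Complex.exp_im]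
  have hcont : ContinuousOn g {w | w.im ∈ Icc 0 Real.pi} := by
    refine Complex.continuous_exp.continuousOn.mul
      ((continuousOn_bmpUpper α s).comp (by fun_prop) fun w hw => ⟨?_, fun h => ?_⟩)
    · rw [mem_ofPred_eq, hexpim]
      exact mul_nonneg (Real.exp_pos _).le (Real.sin_nonneg_of_mem_Icc hw)
    · simp at h
  have hrect := Complex.integral_boundary_rect_eq_zero_of_continuousOn_of_differentiableOn g
    (Real.log r : ℂ) (Real.log ρ + Real.pi * Complex.I)
    (hcont.mono fun w hw => by
      simpa [Complex.mem_reProdIm, uIcc_of_le Real.pi_pos.le] using hw.2)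
    (fun w hw => by
      have hw2 : w.im ∈ Ioo 0 Real.pi := by
        simpa [Complex.mem_reProdIm, Real.pi_pos.le] using hw.2
      have h1 : 0 < (-1 + Complex.exp w).im := by
        rw [hexpim]
        exact mul_pos (Real.exp_pos _) (Real.sin_pos_of_mem_Ioo hw2)
      have h2 : DifferentiableAt ℂ (fun w => bmpUpper α s (-1 + Complex.exp w)) w :=
        (differentiableAt_bmpUpper α s h1).comp w
          (f := fun w => -1 + Complex.exp w) (by fun_prop)
      exact (Complex.differentiable_exp.differentiableAt.mul h2).differentiableWithinAt)
  simp only [Complex.ofReal_re, Complex.ofReal_im, Complex.add_re, Complex.add_im, Complex.mul_re,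
    Complex.mul_im, Complex.I_re, Complex.I_im, mul_zero, mul_one, zero_add, add_zero, sub_zero,
    Complex.ofReal_zero, zero_mul, smul_eq_mul] at hrect
  have hside : ∀ x : ℝ, 0 < x →
      ∫ y in (0 : ℝ)..Real.pi, g (Real.log x + y * Complex.I) = bmpHalf α s x := fun x hx => by
    refine intervalIntegral.integral_congr fun y _ => ?_
    have h1 : Complex.exp (Real.log x + y * Complex.I) = x * Complex.exp (y * Complex.I) := by
      rw [Complex.exp_add, ← Complex.ofReal_exp, Real.exp_log hx]
    simp only [hg, h1, circleMap, zero_add]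
  rw [hside r hr0, hside ρ (by linarith)] at hrect
  have hbotc : Continuous fun x : ℝ => g x :=
    hcont.comp_continuous (by fun_prop) fun x => by simp [Real.pi_pos.le]
  have htopc : Continuous fun x : ℝ => g (x + Real.pi * Complex.I) :=
    hcont.comp_continuous (by fun_prop) fun x => by simp [Real.pi_pos.le]
  have him : ∀ f : ℝ → ℂ, Continuous f → ∀ a b : ℝ, (∫ x in a..b, f x).im = ∫ x in a..b, (f x).im :=
    fun f hf a b => (Complex.imCLM.intervalIntegral_comp_comm (hf.intervalIntegrable a b)).symm
  have hgre : ∀ x : ℝ, (g x).im = Real.exp x * (bmpUpper α s ((-1 + Real.exp x : ℝ) : ℂ)).im :=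
    fun x => by
      simp only [hg]
      rw [← Complex.ofReal_exp, Complex.im_ofReal_mul]
      push_cast
      rfl
  have htop : (∫ x in Real.log r..Real.log ρ, g (x + Real.pi * Complex.I)).im = 0 := by
    rw [him _ htopc]
    refine (intervalIntegral.integral_congr fun x _ => ?_).trans intervalIntegral.integral_zero
    have h1 : Complex.exp (x + Real.pi * Complex.I) = ((-Real.exp x : ℝ) : ℂ) := by
      rw [Complex.exp_add, Complex.exp_pi_mul_I]
      push_cast
      ring
    have h2 : (-1 : ℂ) + ((-Real.exp x : ℝ) : ℂ) = ((-1 - Real.exp x : ℝ) : ℂ) := by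
      push_cast
      ring
    simp only [hg]
    rw [h1, h2, Complex.im_ofReal_mul,
      bmpUpper_ofReal_im_eq_zero α s (Or.inr (by linarith [Real.exp_pos x])), mul_zero]
  have hbot : (∫ x in Real.log r..Real.log ρ, g x).im = ∫ x in Ioo 0 (1 / α),
      (x / (1 - x)) ^ (α * x) * Real.sin (α * Real.pi * x) * Real.exp (-s * x) := by
    have hc : Continuous fun x : ℝ => (g x).im := Complex.continuous_im.comp hbotc
    have hright : ∫ x in (0 : ℝ)..Real.log ρ, (g x).im = 0 := by
      refine (intervalIntegral.integral_congr fun x hx => ?_).trans intervalIntegral.integral_zero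
      rw [uIcc_of_le hlogρ.le] at hx
      simp only [hgre]
      rw [bmpUpper_ofReal_im_eq_zero α s (Or.inl (by linarith [Real.one_le_exp hx.1])), mul_zero]
    have himage : ∀ x ∈ uIcc (Real.log r) 0, 1 - Real.exp x ∈ Icc 0 (1 / α) := fun x hx => by
      rw [uIcc_of_le hlogr.le] at hx
      have h1 := Real.exp_le_one_iff.mpr hx.2
      have h2 := (Real.log_le_iff_le_exp hr0).mp hx.1
      constructor <;> linarith
    have hsubst := intervalIntegral.integral_comp_mul_deriv'' (a := Real.log r) (b := 0)
      (f := fun x => 1 - Real.exp x) (f' := fun x => -Real.exp x)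
      (g := fun x : ℝ => (bmpUpper α s (-x)).im) (by fun_prop)
      (fun x _ => ((Real.hasDerivAt_exp x).const_sub 1).hasDerivWithinAt) (by fun_prop)
      ((continuousOn_bmpUpper_neg_im hα s).mono (by
        rintro _ ⟨x, hx, rfl⟩
        exact himage x hx))
    have hleft : ∫ x in Real.log r..0, (g x).im
        = -∫ x in Real.log r..0,
            ((fun x : ℝ => (bmpUpper α s (-x)).im) ∘ fun x => 1 - Real.exp x) x * -Real.exp x := by
      rw [← intervalIntegral.integral_neg]
      refine intervalIntegral.integral_congr fun x _ => ?_
      simp only [hgre, Function.comp_apply]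
      rw [show -((1 - Real.exp x : ℝ) : ℂ) = ((-1 + Real.exp x : ℝ) : ℂ) by push_cast; ring]
      ring
    rw [him _ hbotc, ← intervalIntegral.integral_add_adjacent_intervals
      (hc.intervalIntegrable _ 0) (hc.intervalIntegrable 0 _), hright, add_zero, hleft, hsubst,
      Real.exp_log hr0, Real.exp_zero, sub_self, ← intervalIntegral.integral_symm,
      show 1 - r = 1 / α by rw [hr]; ring, intervalIntegral.integral_of_le hα0.le,
      integral_Ioc_eq_integral_Ioo]
    exact setIntegral_congr_fun measurableSet_Ioo fun x hx =>
      bmpUpper_neg_ofReal_im α s hx.1 (hx.2.trans hα1)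
  have hfin := congrArg Complex.im hrect
  simp only [Complex.sub_im, Complex.add_im, htop, hbot, Complex.I_mul_im, Complex.zero_im] at hfin
  linarith

theorem completelyMonotonicOn_laplace_of_bounded {w : ℝ → ℝ} {b : ℝ}
    (hw : ∀ x ∈ Ioo 0 b, 0 ≤ w x) (hm : Measurable w)
    (hint : ∀ t : ℝ, IntegrableOn (fun x => w x * Real.exp (-t * x)) (Ioo 0 b)) {c : ℝ} (hc : 0 ≤ c) :
    CompletelyMonotonicOn fun t => c * ∫ x in Ioo 0 b, w x * Real.exp (-t * x) := by
  set μ : Measure ℝ := (volume.restrict (Ioo 0 b)).withDensity fun x => (w x).toNNReal with hμ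
  have hmN : Measurable fun x => (w x).toNNReal := hm.real_toNNReal
  have hI : ∀ f : ℝ → ℝ, ∫ x, f x ∂μ = ∫ x in Ioo 0 b, w x * f x := fun f => by
    rw [hμ, integral_withDensity_eq_integral_smul hmN]
    refine setIntegral_congr_fun measurableSet_Ioo fun x hx => ?_
    simp [NNReal.smul_def, Real.coe_toNNReal _ (hw x hx)]
  have hset : ProbabilityTheory.integrableExpSet (fun x : ℝ => -x) μ = univ := by
    refine eq_univ_of_forall fun t => ?_
    rw [ProbabilityTheory.integrableExpSet, mem_ofPred_eq, hμ,
      integrable_withDensity_iff_integrable_smul hmN]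
    refine (hint t).congr_fun (fun x hx => ?_) measurableSet_Ioo
    simp [NNReal.smul_def, Real.coe_toNNReal _ (hw x hx)]
  have hfun : (fun t => c * ∫ x in Ioo 0 b, w x * Real.exp (-t * x))
      = fun t => c * ProbabilityTheory.mgf (fun x : ℝ => -x) μ t := by
    funext t
    rw [ProbabilityTheory.mgf, hI]
    simp
  have hC : ContDiff ℝ (⊤ : ℕ∞) (ProbabilityTheory.mgf (fun x : ℝ => -x) μ) := by
    have h := ProbabilityTheory.analyticOn_mgf (X := fun x : ℝ => -x) (μ := μ)
    rw [hset, interior_univ] at h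
    exact contDiffOn_univ.mp (h.contDiffOn uniqueDiffOn_univ)
  rw [hfun]
  refine ⟨(contDiff_const.mul hC).contDiffOn, fun n x hx => ?_⟩
  rw [iteratedDerivWithin_of_isOpen isOpen_Ioi hx,
    iteratedDeriv_const_mul_field, ProbabilityTheory.iteratedDeriv_mgf (by simp [hset]), mul_left_comm,
    ← integral_const_mul]
  refine mul_nonneg hc ?_
  rw [hI]
  refine setIntegral_nonneg measurableSet_Ioo fun y hy => ?_
  have h1 : w y * ((-1) ^ n * ((-y) ^ n * Real.exp (x * -y))) = w y * (y ^ n * Real.exp (x * -y)) := by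
    rw [← mul_assoc ((-1 : ℝ) ^ n), ← mul_pow, neg_one_mul, neg_neg]
  have h2 := hw y hy
  have h3 := hy.1.le
  rw [h1]
  positivity

/-- For `α > 1`:
`φ_α(s) = (1/π)∫_0^{1/α} (x/(1−x))^{αx} sin(απx) e^{−sx} dx − Φ(α,s)` where `Φ(α,s)` is the
contour integral of `h_α(z)e^{sz}` over the circle `|z+1| = 1 − 1/α`; the first term is a
completely monotonic function of `s`. -/
theorem stmt12 (α : ℝ) (hα : 1 < α) :
    (∀ s : ℝ, 0 ≤ s →
      MeasureTheory.IntegrableOn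
        (fun x : ℝ => (x / (1 - x)) ^ (α * x) * Real.sin (α * Real.pi * x) * Real.exp (-s * x))
        (Set.Ioo 0 (1 / α)) ∧
      (bmpPhiR α s : ℂ) =
        (((1 / Real.pi) * ∫ x in Set.Ioo (0 : ℝ) (1 / α),
          (x / (1 - x)) ^ (α * x) * Real.sin (α * Real.pi * x) * Real.exp (-s * x) : ℝ) : ℂ) -
        (1 / (2 * (Real.pi : ℂ) * Complex.I)) *
          (∮ z in C(-1, 1 - 1 / α),
            Complex.exp ((α : ℂ) * z * Complex.log (1 + 1 / z)) * Complex.exp ((s : ℂ) * z))) ∧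
    CompletelyMonotonicOn (fun t : ℝ => (1 / Real.pi) * ∫ x in Set.Ioo (0 : ℝ) (1 / α),
      (x / (1 - x)) ^ (α * x) * Real.sin (α * Real.pi * x) * Real.exp (-t * x)) := by

  have hα0 : 0 < α := by linarith
  have hα1 : 1 / α < 1 := (div_lt_one hα0).mpr hα
  have hpi : (Real.pi : ℂ) ≠ 0 := Complex.ofReal_ne_zero.mpr Real.pi_ne_zero
  refine ⟨fun s _ => ⟨integrableOn_bmp_density hα s, ?_⟩, ?_⟩
  · have hρ : 1 < 2 * (1 + α) + 1 := by linarith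
    have h1 := circleIntegral_exp_mul_log_eq_bmpPhiR hα0 s le_rfl
    rw [circleIntegral_eq_bmpHalf α s (by linarith)] at h1
    rw [circleIntegral_eq_bmpHalf α s (sub_pos.mpr hα1), ← re_bmpHalf_sub_re_bmpHalf hα s hρ]
    have h2 : (bmpPhiR α s : ℂ) = -((bmpHalf α s (2 * (1 + α) + 1)).re : ℂ) / Real.pi := by
      rw [eq_div_iff hpi]
      apply mul_left_cancel₀ (mul_ne_zero two_ne_zero Complex.I_ne_zero)
      linear_combination h1
    rw [h2]
    push_cast
    field_simp
    ring
  · refine completelyMonotonicOn_laplace_of_bounded (fun x hx => ?_) (by fun_prop)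
      (integrableOn_bmp_density hα) (by positivity)
    have h1 : 0 < 1 - x := by linarith [hx.2]
    refine mul_nonneg (Real.rpow_nonneg (div_nonneg hx.1.le h1.le) _)
      (Real.sin_nonneg_of_nonneg_of_le_pi ?_ ?_)
    · have := hx.1
      positivity
    · have h2 : x * α ≤ 1 := (le_div_iff₀ hα0).mp hx.2.le
      calc α * Real.pi * x = Real.pi * (x * α) := by ring
        _ ≤ Real.pi * 1 := by gcongr
        _ = Real.pi := mul_one _
end

section
/- For every n ≥ 1 there exist real coefficients c_{n,1}, …, c_{n,n} such that p_n(α) = Σ_{k=1}^{n} c_{n,k} α^k for all α ∈ ℂ, with c_{n,k} > 0 for all 1 ≤ k ≤ n, c_{n,1} = 1/(n+1), and c_{n,n} = 1/(2^n · n!). -/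
open MeasureTheory Filter Set Asymptotics

/-- The coefficient of `α ^ k` in `bmpP α n`. -/
noncomputable def bmpCoeff : ℕ → ℕ → ℝ
  | 0, 0 => 1
  | 0, _ + 1 => 0
  | _ + 1, 0 => 0
  | n + 1, k + 1 => (1 / (n + 1)) *
      ∑ j ∈ Finset.range (n + 1), ((j + 1 : ℝ) / (j + 2)) * bmpCoeff (n - j) k
  termination_by n => n
  decreasing_by exact Nat.lt_succ_of_le (Nat.sub_le n j)

theorem bmpCoeff_succ_succ (n k : ℕ) : bmpCoeff (n + 1) (k + 1) = (1 / (n + 1)) *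
    ∑ j ∈ Finset.range (n + 1), ((j + 1 : ℝ) / (j + 2)) * bmpCoeff (n - j) k := by
  rw [bmpCoeff]

theorem bmpCoeff_zero_right {n : ℕ} (hn : n ≠ 0) : bmpCoeff n 0 = 0 := by
  obtain ⟨m, rfl⟩ := Nat.exists_eq_succ_of_ne_zero hn
  rw [Nat.succ_eq_add_one, bmpCoeff]

theorem bmpCoeff_eq_zero_of_lt {n k : ℕ} (h : n < k) : bmpCoeff n k = 0 := by
  induction k generalizing n with
  | zero => omega
  | succ k ih =>
    cases n with
    | zero => rw [bmpCoeff]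
    | succ n =>
      rw [bmpCoeff_succ_succ, Finset.sum_eq_zero, mul_zero]
      intro j _
      rw [ih (by omega), mul_zero]

theorem bmpCoeff_nonneg (n k : ℕ) : 0 ≤ bmpCoeff n k := by
  induction k generalizing n with
  | zero => cases n <;> rw [bmpCoeff]; exact zero_le_one
  | succ k ih =>
    cases n with
    | zero => rw [bmpCoeff]
    | succ n =>
      rw [bmpCoeff_succ_succ]
      exact mul_nonneg (by positivity)
        (Finset.sum_nonneg fun j _ => mul_nonneg (by positivity) (ih _))

theorem bmpCoeff_one_right (n : ℕ) : bmpCoeff (n + 1) 1 = 1 / (n + 2) := by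
  rw [bmpCoeff_succ_succ, Finset.sum_range_succ, Finset.sum_eq_zero, Nat.sub_self, bmpCoeff]
  · field_simp
    ring
  · intro j hj
    rw [bmpCoeff_zero_right (by have := Finset.mem_range.mp hj; omega), mul_zero]

theorem bmpCoeff_pos {n k : ℕ} (hk : 1 ≤ k) (hkn : k ≤ n) : 0 < bmpCoeff n k := by
  induction k, hk using Nat.le_induction generalizing n with
  | base =>
    obtain ⟨m, rfl⟩ := Nat.exists_eq_add_of_le' hkn
    rw [bmpCoeff_one_right]
    positivity
  | succ k hk ih =>
    obtain ⟨m, rfl⟩ := Nat.exists_eq_add_of_le' (le_trans (Nat.le_add_left 1 k) hkn)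
    rw [bmpCoeff_succ_succ]
    refine mul_pos (by positivity) (Finset.sum_pos' (fun j _ =>
      mul_nonneg (by positivity) (bmpCoeff_nonneg _ _)) ⟨0, by simp, ?_⟩)
    exact mul_pos (by positivity) (ih (by omega))

theorem bmpCoeff_self (n : ℕ) : bmpCoeff n n = 1 / (2 ^ n * n.factorial) := by
  induction n with
  | zero => rw [bmpCoeff]; simp
  | succ n ih =>
    rw [bmpCoeff_succ_succ, Finset.sum_eq_single 0, Nat.sub_zero, ih, Nat.factorial_succ]
    · push_cast
      field_simp
      ring
    · intro j hj hj0
      rw [bmpCoeff_eq_zero_of_lt (by have := Finset.mem_range.mp hj; omega), mul_zero]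
    · simp

theorem bmpP_eq_sum_bmpCoeff (α : ℂ) {n N : ℕ} (h : n ≤ N) :
    bmpP α n = ∑ k ∈ Finset.range (N + 1), (bmpCoeff n k : ℂ) * α ^ k := by
  induction N generalizing n with
  | zero =>
    obtain rfl : n = 0 := by omega
    simp [bmpP, bmpCoeff]
  | succ N ih =>
    rw [Finset.sum_range_succ']
    cases n with
    | zero => simp [bmpP, bmpCoeff]
    | succ n =>
      rw [bmpP, Finset.sum_congr rfl fun j _ => by rw [ih (n := n - j) (by omega)],
        bmpCoeff_zero_right n.succ_ne_zero]
      simp only [bmpCoeff_succ_succ, Complex.ofReal_zero, zero_mul, add_zero]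
      push_cast
      simp only [Finset.mul_sum, Finset.sum_mul]
      rw [Finset.sum_comm]
      refine Finset.sum_congr rfl fun k _ => Finset.sum_congr rfl fun j _ => ?_
      ring

/-- For `n ≥ 1`, `p_n(α) = Σ_{k=1}^n c_{n,k} α^k` with `c_{n,k} > 0`, `c_{n,1} = 1/(n+1)`
and `c_{n,n} = 1/(2^n n!)`. -/
theorem stmt13 (n : ℕ) (hn : 1 ≤ n) :
    ∃ c : ℕ → ℝ,
      (∀ k : ℕ, 1 ≤ k → k ≤ n → 0 < c k) ∧
      c 1 = 1 / (n + 1) ∧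
      c n = 1 / (2 ^ n * n.factorial) ∧
      ∀ α : ℂ, bmpP α n = ∑ k ∈ Finset.Icc 1 n, (c k : ℂ) * α ^ k := by
  refine ⟨bmpCoeff n, fun k hk hkn => bmpCoeff_pos hk hkn, ?_, bmpCoeff_self n, fun α => ?_⟩
  · obtain ⟨m, rfl⟩ := Nat.exists_eq_add_of_le' hn
    rw [bmpCoeff_one_right]
    push_cast
    ring
  · rw [bmpP_eq_sum_bmpCoeff α le_rfl, Finset.range_eq_Ico,
      Finset.sum_eq_sum_Ico_succ_bot (Nat.succ_pos n), bmpCoeff_zero_right (by omega)]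
    simp only [Complex.ofReal_zero, zero_mul, zero_add]
    rfl
end

section
/- For all α, β ∈ ℂ and every integer n ≥ 0 one has the addition formula p_n(α+β) = Σ_{k=0}^{n} p_k(α) · p_{n−k}(β). -/
open MeasureTheory Filter Set Asymptotics

open PowerSeries in
/-- The generating function of `bmpP α` solves `F' = α A F`, where `A = ∑ (k + 1) / (k + 2) X ^ k`. -/
theorem derivative_mk_bmpP {K : Type*} [Field K] [CharZero K] (α : K) :
    derivative K (mk (bmpP α)) =
      C α * (mk (fun k : ℕ => (k + 1 : K) / (k + 2)) * mk (bmpP α)) := by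
  ext n
  have hn : (n + 1 : K) ≠ 0 := n.cast_add_one_ne_zero
  rw [coeff_derivative, coeff_C_mul, coeff_mul, coeff_mk, bmpP,
    Finset.Nat.sum_antidiagonal_eq_sum_range_succ_mk]
  simp only [coeff_mk]
  field_simp

open PowerSeries in
/-- The equation `F' = α A F` with `F(0) = 1` determines `F` as the generating function of
`bmpP α`. -/
theorem coeff_eq_bmpP_of_derivative_eq {K : Type*} [Field K] [CharZero K] {α : K} {F : K⟦X⟧}
    (h0 : coeff 0 F = 1)
    (hF : derivative K F = C α * (mk (fun k : ℕ => (k + 1 : K) / (k + 2)) * F)) (n : ℕ) :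
    coeff n F = bmpP α n := by
  induction n using Nat.strong_induction_on with
  | _ n ih =>
    cases n with
    | zero => rw [h0, bmpP]
    | succ n =>
      have hn : (n + 1 : K) ≠ 0 := n.cast_add_one_ne_zero
      have h := congrArg (coeff n) hF
      rw [coeff_derivative, coeff_C_mul, coeff_mul,
        Finset.Nat.sum_antidiagonal_eq_sum_range_succ_mk] at h
      simp only [coeff_mk] at h
      rw [bmpP, div_mul_eq_mul_div, eq_div_iff hn, h]
      congr 1
      refine Finset.sum_congr rfl fun k _ => ?_
      rw [ih (n - k) (by omega)]

/-- The addition formula `p_n(α+β) = Σ_{k=0}^n p_k(α) p_{n−k}(β)`. -/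
theorem stmt15 (α β : ℂ) (n : ℕ) :
    bmpP (α + β) n = ∑ k ∈ Finset.range (n + 1), bmpP α k * bmpP β (n - k) := by
  have h := coeff_eq_bmpP_of_derivative_eq (α := α + β)
    (F := PowerSeries.mk (bmpP α) * PowerSeries.mk (bmpP β))
    (by simp [PowerSeries.coeff_mul, bmpP])
    (by
      rw [Derivation.leibniz, derivative_mk_bmpP, derivative_mk_bmpP, map_add, smul_eq_mul,
        smul_eq_mul]
      ring) n
  rw [← h, PowerSeries.coeff_mul, Finset.Nat.sum_antidiagonal_eq_sum_range_succ_mk]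
  simp only [PowerSeries.coeff_mk]
end

section
/- For 0 < α ≤ 1 the sequence (p_n(α))_{n≥0} is strictly decreasing, and for α ≥ 2 it is (weakly) increasing. Moreover, lim_{n→∞} p_n(α) = 0 when 0 < α < 1; lim_{n→∞} p_n(1) = e^{−1}; and lim_{n→∞} p_n(α) = ∞ when α > 1. -/
open MeasureTheory Filter Set Asymptotics

theorem bmpP_succ_mul (α : ℝ) (n : ℕ) :
    ((n : ℝ) + 1) * bmpP α (n + 1) =
      α * ∑ k ∈ Finset.range (n + 1), ((k + 1 : ℝ) / (k + 2)) * bmpP α (n - k) := by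
  have h : (n : ℝ) + 1 ≠ 0 := by positivity
  rw [bmpP]
  field_simp

theorem bmpP_pos {α : ℝ} (hα : 0 < α) (n : ℕ) : 0 < bmpP α n := by
  induction n using Nat.strong_induction_on with
  | _ n ih =>
    cases n with
    | zero => simp [bmpP]
    | succ n =>
      rw [bmpP]
      refine mul_pos (by positivity) (Finset.sum_pos (fun k _ => ?_) (by simp))
      exact mul_pos (by positivity) (ih _ (by omega))

/-- The differences `p_n - p_{n-1}`, with the convention `p_{-1} = 0`. -/
noncomputable def bmpDiff (α : ℝ) : ℕ → ℝ
  | 0 => 1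
  | n + 1 => bmpP α (n + 1) - bmpP α n

theorem sum_bmpDiff (α : ℝ) (n : ℕ) :
    ∑ k ∈ Finset.range (n + 1), bmpDiff α k = bmpP α n := by
  induction n with
  | zero => simp [bmpDiff, bmpP]
  | succ n ih => rw [Finset.sum_range_succ, ih, bmpDiff]; ring

theorem sum_bmpDiff_reflect (α : ℝ) (n : ℕ) :
    ∑ k ∈ Finset.range (n + 1), bmpDiff α (n - k) = bmpP α n := by
  rw [← sum_bmpDiff α n, ← Finset.sum_range_reflect (bmpDiff α)]
  simp

theorem bmpDiff_succ_mul (α : ℝ) (n : ℕ) :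
    ((n : ℝ) + 1) * bmpDiff α (n + 1) =
      ∑ k ∈ Finset.range (n + 1), (α * ((k + 1 : ℝ) / (k + 2)) - 1) * bmpDiff α (n - k) := by
  have hsplit : ∑ k ∈ Finset.range (n + 1), (α * ((k + 1 : ℝ) / (k + 2)) - 1) * bmpDiff α (n - k)
      = α * ∑ k ∈ Finset.range (n + 1), ((k + 1 : ℝ) / (k + 2)) * bmpDiff α (n - k)
        - bmpP α n := by
    rw [← sum_bmpDiff_reflect, Finset.mul_sum, ← Finset.sum_sub_distrib]
    exact Finset.sum_congr rfl fun k _ => by ring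
  rw [hsplit, bmpDiff, mul_sub, bmpP_succ_mul]
  cases n with
  | zero => simp [bmpDiff, bmpP]
  | succ n =>
    have h := bmpP_succ_mul α n
    have hd : ∑ k ∈ Finset.range (n + 1), ((k + 1 : ℝ) / (k + 2)) * bmpDiff α (n + 1 - k)
        = ∑ k ∈ Finset.range (n + 1), ((k + 1 : ℝ) / (k + 2)) * bmpP α (n + 1 - k)
          - ∑ k ∈ Finset.range (n + 1), ((k + 1 : ℝ) / (k + 2)) * bmpP α (n - k) := by
      rw [← Finset.sum_sub_distrib]
      refine Finset.sum_congr rfl fun k hk => ?_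
      have hk' : k ≤ n := Nat.lt_succ_iff.mp (Finset.mem_range.mp hk)
      rw [Nat.sub_add_comm hk', bmpDiff]
      ring
    rw [Finset.sum_range_succ, Finset.sum_range_succ _ (n + 1), hd]
    have h0 : bmpP α 0 = 1 := by simp [bmpP]
    simp only [Nat.sub_self, bmpDiff, h0]
    push_cast
    linear_combination (-1 : ℝ) * h

theorem bmpP_monotone {α : ℝ} (hα : 2 ≤ α) : Monotone (fun n : ℕ => bmpP α n) := by
  have hd : ∀ n, 0 ≤ bmpDiff α n := by
    intro n
    induction n using Nat.strong_induction_on with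
    | _ n ih =>
      cases n with
      | zero => simp [bmpDiff]
      | succ n =>
        refine nonneg_of_mul_nonneg_right (a := (n : ℝ) + 1) ?_ (by positivity)
        rw [bmpDiff_succ_mul]
        refine Finset.sum_nonneg fun k _ => mul_nonneg ?_ (ih _ (by omega))
        have hk : (1 : ℝ) / 2 ≤ (k + 1 : ℝ) / (k + 2) := by
          rw [div_le_div_iff₀ (by positivity) (by positivity)]
          have : (0 : ℝ) ≤ k := k.cast_nonneg
          linarith
        nlinarith
  exact monotone_nat_of_le_succ fun n => sub_nonneg.mp (hd (n + 1))

/-- If `d 0 = 1` and `(n + 1) d (n + 1) = -∑ a k * d (n - k)` with `a` positive and log-convex and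
`a 0 ^ 2 < a 1`, then all later terms of `d` are negative. -/
theorem neg_of_logConvex_recurrence {a d : ℕ → ℝ} (ha : ∀ n, 0 < a n)
    (hconv : ∀ k n, k ≤ n → a (k + 1) * a n ≤ a (n + 1) * a k) (ha01 : a 0 * a 0 < a 1)
    (hd0 : d 0 = 1)
    (hd : ∀ n : ℕ, ((n : ℝ) + 1) * d (n + 1) = -∑ k ∈ Finset.range (n + 1), a k * d (n - k))
    (n : ℕ) : d (n + 1) < 0 := by
  induction n using Nat.strong_induction_on with
  | _ n ih =>
    cases n with
    | zero =>
      have h := hd 0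
      simp only [zero_add, Finset.range_one, Finset.sum_singleton, Nat.sub_zero, hd0] at h
      have := ha 0
      push_cast at h
      linarith
    | succ n =>
      have h1 := hd n
      have h2 := hd (n + 1)
      rw [Finset.sum_range_succ, Nat.sub_self, hd0] at h1
      rw [Finset.sum_range_succ, Nat.sub_self, hd0, Finset.sum_range_succ', Nat.sub_zero] at h2
      have hS : a (n + 1) * ∑ k ∈ Finset.range n, a k * d (n - k) ≤
          a n * ∑ k ∈ Finset.range n, a (k + 1) * d (n + 1 - (k + 1)) := by
        rw [Finset.mul_sum, Finset.mul_sum]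
        refine Finset.sum_le_sum fun k hk => ?_
        have hk' : k < n := Finset.mem_range.mp hk
        have hdk : d (n - k) < 0 := by
          have := ih (n - k - 1) (by omega)
          rwa [show n - k - 1 + 1 = n - k by omega] at this
        rw [Nat.add_sub_add_right]
        nlinarith [hconv k n hk'.le]
      have hdn := ih n (Nat.lt_succ_self n)
      have hratio : a 0 * a n < ((n : ℝ) + 1) * a (n + 1) := by
        have h3 := hconv 0 n n.zero_le
        have h4 : a 0 * a n < a (n + 1) := by
          have : a 0 * (a 0 * a n) < a 0 * a (n + 1) := by nlinarith [ha n]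
          exact lt_of_mul_lt_mul_left this (ha 0).le
        nlinarith [ha (n + 1), (n.cast_nonneg : (0 : ℝ) ≤ n)]
      have key : a n * (((n + 1 : ℕ) : ℝ) + 1) * d (n + 1 + 1) ≤
          (((n : ℝ) + 1) * a (n + 1) - a 0 * a n) * d (n + 1) := by
        rw [mul_assoc, h2, sub_mul,
          show ((n : ℝ) + 1) * a (n + 1) * d (n + 1) = a (n + 1) * (((n : ℝ) + 1) * d (n + 1)) by
            ring, h1]
        linarith
      have hneg := mul_neg_of_pos_of_neg (sub_pos.mpr hratio) hdn
      have hpos : 0 < a n * (((n + 1 : ℕ) : ℝ) + 1) := mul_pos (ha n) (by positivity)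
      by_contra! hcon
      have := mul_nonneg hpos.le hcon
      linarith

theorem bmpDiff_succ_neg {α : ℝ} (hα : 0 < α) (hα1 : α ≤ 1) (n : ℕ) : bmpDiff α (n + 1) < 0 := by
  refine neg_of_logConvex_recurrence (a := fun k => 1 - α + α / ((k : ℝ) + 2)) (fun k => ?_)
    (fun k n hkn => ?_) ?_ rfl (fun n => ?_) n
  · have : 0 < α / ((k : ℝ) + 2) := by positivity
    linarith
  · obtain ⟨m, rfl⟩ := Nat.exists_eq_add_of_le hkn
    have hβ : 0 ≤ 1 - α := by linarith
    have hid : (1 - α + α / (((k + m + 1 : ℕ) : ℝ) + 2)) * (1 - α + α / ((k : ℝ) + 2))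
        - (1 - α + α / (((k + 1 : ℕ) : ℝ) + 2)) * (1 - α + α / (((k + m : ℕ) : ℝ) + 2))
        = ((1 - α) * α * (m * (2 * k + m + 5)) + α ^ 2 * m)
          / ((k + 2) * (k + 3) * (k + m + 2) * (k + m + 3)) := by
      have h1 : (k : ℝ) + 2 ≠ 0 := by positivity
      have h2 : (k : ℝ) + 3 ≠ 0 := by positivity
      have h3 : (k : ℝ) + m + 2 ≠ 0 := by positivity
      have h4 : (k : ℝ) + m + 3 ≠ 0 := by positivity
      have e1 : (((k + m + 1 : ℕ) : ℝ) + 2) = k + m + 3 := by push_cast; ring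
      have e2 : (((k + 1 : ℕ) : ℝ) + 2) = k + 3 := by push_cast; ring
      rw [e1, e2, Nat.cast_add]
      field_simp
      ring
    refine sub_nonneg.mp ?_
    rw [hid]
    positivity
  · push_cast
    norm_num
    nlinarith
  · rw [bmpDiff_succ_mul, ← Finset.sum_neg_distrib]
    refine Finset.sum_congr rfl fun k _ => ?_
    have : (k : ℝ) + 2 ≠ 0 := by positivity
    field_simp
    ring

theorem bmpP_strictAnti {α : ℝ} (hα : 0 < α) (hα1 : α ≤ 1) :
    StrictAnti (fun n : ℕ => bmpP α n) :=
  strictAnti_nat_of_succ_lt fun n => sub_neg.mp (bmpDiff_succ_neg hα hα1 n)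

theorem bmpP_tendsto_iInf {α : ℝ} (hα : 0 < α) (hα1 : α ≤ 1) :
    Tendsto (fun n : ℕ => bmpP α n) atTop (nhds (⨅ n, bmpP α n)) :=
  tendsto_atTop_ciInf (bmpP_strictAnti hα hα1).antitone
    ⟨0, by rintro _ ⟨n, rfl⟩; exact (bmpP_pos hα n).le⟩

theorem bmpP_tendsto_zero {α : ℝ} (hα : 0 < α) (hα1 : α < 1) :
    Tendsto (fun n : ℕ => bmpP α n) atTop (nhds 0) := by
  have hL := bmpP_tendsto_iInf hα hα1.le
  set L := ⨅ n, bmpP α n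
  have hL0 : 0 ≤ L := ge_of_tendsto' hL fun n => (bmpP_pos hα n).le
  have hces := ((hL.cesaro).comp (tendsto_add_atTop_nat 1)).const_mul α
  have hle : L ≤ α * L := by
    refine le_of_tendsto_of_tendsto' (hL.comp (tendsto_add_atTop_nat 1)) hces fun n => ?_
    have hn : (0 : ℝ) < (n : ℝ) + 1 := by positivity
    simp only [Function.comp_apply]
    refine le_of_mul_le_mul_left ?_ hn
    rw [bmpP_succ_mul]
    push_cast
    rw [show ((n : ℝ) + 1) * (α * (((n : ℝ) + 1)⁻¹ * ∑ i ∈ Finset.range (n + 1), bmpP α i))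
      = α * ∑ i ∈ Finset.range (n + 1), bmpP α i by field_simp,
      ← Finset.sum_range_reflect (bmpP α)]
    refine mul_le_mul_of_nonneg_left (Finset.sum_le_sum fun k _ => ?_) hα.le
    simp only [Nat.add_sub_cancel]
    refine mul_le_of_le_one_left (bmpP_pos hα _).le ?_
    rw [div_le_one (by positivity)]
    linarith
  have : L = 0 := by nlinarith
  rwa [this] at hL

theorem summable_mul_pow_of_bounded {c : ℕ → ℝ} {C : ℝ} (hc : ∀ n, |c n| ≤ C) {x : ℝ}
    (hx : |x| < 1) : Summable fun n => ‖c n * x ^ n‖ := by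
  refine Summable.of_nonneg_of_le (fun n => norm_nonneg _) (fun n => ?_)
    ((summable_geometric_of_abs_lt_one (r := |x|) (by rwa [abs_abs])).mul_left C)
  rw [Real.norm_eq_abs, abs_mul, abs_pow]
  exact mul_le_mul_of_nonneg_right (hc n) (by positivity)

theorem hasDerivAt_tsum_mul_pow_of_bounded {c : ℕ → ℝ} {C : ℝ} (hc : ∀ n, |c n| ≤ C) {x : ℝ}
    (hx : |x| < 1) :
    HasDerivAt (fun y : ℝ => ∑' n, c n * y ^ n)
      (∑' n : ℕ, ((n : ℝ) + 1) * c (n + 1) * x ^ n) x := by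
  obtain ⟨r, hxr, hr1⟩ := exists_between hx
  have hr0 : 0 < r := (abs_nonneg x).trans_lt hxr
  have hC : 0 ≤ C := (abs_nonneg _).trans (hc 0)
  have hgeo : Summable fun n : ℕ => (n : ℝ) * r ^ (n - 1) := by
    rw [← summable_nat_add_iff 1]
    have h1 := summable_pow_mul_geometric_of_norm_lt_one 1 (r := r)
      (by rwa [Real.norm_eq_abs, abs_of_pos hr0])
    have h2 := summable_geometric_of_lt_one hr0.le hr1
    refine (h1.add h2).congr fun n => ?_
    simp only [Nat.add_sub_cancel]
    push_cast
    ring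
  have hmem : ∀ y ∈ Metric.ball (0 : ℝ) r, |y| < r := fun y hy => by simpa using hy
  have hder := hasDerivAt_tsum_of_isPreconnected (t := Metric.ball (0 : ℝ) r)
    (g := fun (n : ℕ) y => c n * y ^ n) (g' := fun (n : ℕ) y => c n * (n * y ^ (n - 1)))
    (u := fun (n : ℕ) => C * (n * r ^ (n - 1))) (y₀ := 0) (y := x) (hgeo.mul_left C) Metric.isOpen_ball
    (convex_ball 0 r).isPreconnected (fun n y _ => (hasDerivAt_pow n y).const_mul (c n))
    (fun n y hy => by
      rw [Real.norm_eq_abs, abs_mul, abs_mul, abs_pow, Nat.abs_cast]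
      have := hmem y hy
      gcongr
      exact hc n)
    (Metric.mem_ball_self hr0) (summable_mul_pow_of_bounded hc (by simp)).of_norm
    (by simpa using hxr)
  have hsum : Summable fun n : ℕ => c n * (n * x ^ (n - 1)) := by
    refine Summable.of_norm_bounded (hgeo.mul_left C) fun n => ?_
    rw [Real.norm_eq_abs, abs_mul, abs_mul, abs_pow, Nat.abs_cast]
    gcongr
    exact hc n
  rw [hsum.tsum_eq_zero_add] at hder
  refine hder.congr_deriv ?_
  simp only [Nat.cast_zero, zero_mul, mul_zero, zero_add, Nat.add_sub_cancel]
  refine tsum_congr fun n => ?_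
  push_cast
  ring

theorem abs_bmpDiff_one_le (n : ℕ) : |bmpDiff 1 n| ≤ 1 := by
  cases n with
  | zero => simp [bmpDiff]
  | succ n =>
    have h1 := bmpDiff_succ_neg one_pos le_rfl n
    have h2 := bmpP_pos one_pos (n + 1)
    have h3 : bmpP (1 : ℝ) n ≤ bmpP 1 0 := (bmpP_strictAnti one_pos le_rfl).antitone n.zero_le
    rw [abs_of_neg h1, bmpDiff]
    simp only [bmpP] at h3 h2 ⊢
    linarith

theorem sum_inv_mul_succ (n : ℕ) :
    ∑ k ∈ Finset.range n, 1 / ((k : ℝ) * (k + 1)) = if n = 0 then 0 else 1 - 1 / (n : ℝ) := by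
  induction n with
  | zero => simp
  | succ n ih =>
    rw [Finset.sum_range_succ, ih]
    rcases Nat.eq_zero_or_pos n with rfl | hn
    · simp
    · have : (n : ℝ) ≠ 0 := by positivity
      rw [if_neg hn.ne', if_neg n.succ_ne_zero]
      push_cast
      field_simp
      ring

/-- The generating function of the differences `p_n(1) - p_{n-1}(1)` in exponential form. -/
theorem tsum_bmpDiff_one_mul_exp {x : ℝ} (hx0 : 0 ≤ x) (hx : x < 1) :
    (∑' n, bmpDiff 1 n * x ^ n) * Real.exp (∑' n : ℕ, 1 / ((n : ℝ) * (n + 1)) * x ^ n) = 1 := by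
  have hh : ∀ n : ℕ, |1 / ((n : ℝ) * (n + 1))| ≤ 1 := by
    intro n
    rcases Nat.eq_zero_or_pos n with rfl | hn
    · simp
    · have : (1 : ℝ) ≤ n := by exact_mod_cast hn
      rw [abs_of_nonneg (by positivity), div_le_one (by positivity)]
      nlinarith
  have hk : ∀ n : ℕ, |1 / ((n : ℝ) + 2)| ≤ 1 := by
    intro n
    rw [abs_of_nonneg (by positivity), div_le_one (by positivity)]
    linarith [(n.cast_nonneg : (0 : ℝ) ≤ n)]
  set G : ℝ → ℝ := fun y => ∑' n, bmpDiff 1 n * y ^ n with hG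
  set H : ℝ → ℝ := fun y => ∑' n : ℕ, 1 / ((n : ℝ) * (n + 1)) * y ^ n with hH
  have hderiv : ∀ y ∈ Set.Ico (0 : ℝ) 1, HasDerivAt (fun y => G y * Real.exp (H y)) 0 y := by
    rintro y ⟨hy0, hy1⟩
    have hy : |y| < 1 := by rwa [abs_of_nonneg hy0]
    have hG' := hasDerivAt_tsum_mul_pow_of_bounded abs_bmpDiff_one_le hy
    have hH' := hasDerivAt_tsum_mul_pow_of_bounded hh hy
    have hHval : ∑' n : ℕ, ((n : ℝ) + 1) * (1 / (((n + 1 : ℕ) : ℝ) * ((n + 1 : ℕ) + 1))) * y ^ n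
        = ∑' n : ℕ, 1 / ((n : ℝ) + 2) * y ^ n := by
      refine tsum_congr fun n => ?_
      congr 1
      push_cast
      field_simp
      ring
    have hGval : ∑' n : ℕ, ((n : ℝ) + 1) * bmpDiff 1 (n + 1) * y ^ n
        = -((∑' n : ℕ, 1 / ((n : ℝ) + 2) * y ^ n) * G y) := by
      rw [hG, tsum_mul_tsum_eq_tsum_sum_range_of_summable_norm
        (summable_mul_pow_of_bounded hk hy) (summable_mul_pow_of_bounded abs_bmpDiff_one_le hy),
        ← tsum_neg]
      refine tsum_congr fun n => ?_
      rw [bmpDiff_succ_mul, Finset.sum_mul, ← Finset.sum_neg_distrib]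
      refine Finset.sum_congr rfl fun k hk => ?_
      have hk' : k ≤ n := Nat.lt_succ_iff.mp (Finset.mem_range.mp hk)
      have h2 : (k : ℝ) + 2 ≠ 0 := by positivity
      rw [← Nat.add_sub_cancel' hk', pow_add, Nat.add_sub_cancel_left]
      field_simp
      ring
    rw [hHval] at hH'
    rw [hGval] at hG'
    refine (hG'.mul hH'.exp).congr_deriv ?_
    rw [hG]
    ring
  have hconst := constant_of_has_deriv_right_zero (a := 0) (b := x)
    (f := fun y => G y * Real.exp (H y))
    (fun y hy => (hderiv y ⟨hy.1, hy.2.trans_lt hx⟩).continuousAt.continuousWithinAt)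
    (fun y hy => (hderiv y ⟨hy.1, hy.2.trans hx⟩).hasDerivWithinAt) x ⟨hx0, le_rfl⟩
  have hG0 : G 0 = 1 := by
    rw [hG]
    simp only
    rw [tsum_eq_single 0 (fun n hn => by simp [hn])]
    simp [bmpDiff]
  have hH0 : H 0 = 0 := by
    rw [hH]
    simp only
    rw [tsum_eq_single 0 (fun n hn => by simp [hn])]
    simp
  simpa only [hG0, hH0, Real.exp_zero, mul_one] using hconst

theorem bmpP_one_tendsto :
    Tendsto (fun n : ℕ => bmpP (1 : ℝ) n) atTop (nhds (Real.exp (-1))) := by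
  have hL := bmpP_tendsto_iInf one_pos le_rfl
  set L := ⨅ n, bmpP (1 : ℝ) n
  have hG : Tendsto (fun n => ∑ k ∈ Finset.range n, bmpDiff 1 k) atTop (nhds L) := by
    rw [← tendsto_add_atTop_iff_nat 1]
    simpa only [sum_bmpDiff] using hL
  have hH : Tendsto (fun n => ∑ k ∈ Finset.range n, 1 / ((k : ℝ) * (k + 1))) atTop (nhds 1) := by
    rw [← tendsto_add_atTop_iff_nat 1]
    simp only [sum_inv_mul_succ, Nat.succ_ne_zero, if_false, Nat.cast_add, Nat.cast_one]
    simpa using (tendsto_one_div_add_atTop_nhds_zero_nat (𝕜 := ℝ)).const_sub 1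
  have hlim := (Real.tendsto_tsum_powerSeries_nhdsWithin_lt hG).mul
    ((Real.continuous_exp.tendsto 1).comp (Real.tendsto_tsum_powerSeries_nhdsWithin_lt hH))
  have hone : L * Real.exp 1 = 1 := by
    refine tendsto_nhds_unique hlim (tendsto_const_nhds.congr' ?_)
    filter_upwards [Ioo_mem_nhdsLT (show (0 : ℝ) < 1 from one_pos)] with x hx
    exact (tsum_bmpDiff_one_mul_exp hx.1.le hx.2).symm
  have : L = Real.exp (-1) := by
    rw [Real.exp_neg, eq_inv_of_mul_eq_one_left hone]
  rwa [this] at hL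

theorem bmpP_one_le {α : ℝ} (hα : 1 ≤ α) (n : ℕ) : bmpP 1 n ≤ bmpP α n := by
  induction n using Nat.strong_induction_on with
  | _ n ih =>
    cases n with
    | zero => simp [bmpP]
    | succ n =>
      rw [bmpP, bmpP]
      refine mul_le_mul (by gcongr) (Finset.sum_le_sum fun k _ => ?_)
        (Finset.sum_nonneg fun k _ => ?_) (by positivity)
      · exact mul_le_mul_of_nonneg_left (ih _ (by omega)) (by positivity)
      · exact mul_nonneg (by positivity) (bmpP_pos one_pos _).le

theorem tendsto_sum_div_add (N : ℕ) :
    Tendsto (fun m : ℕ => (∑ k ∈ Finset.range m, (k + 1 : ℝ) / (k + 2)) / ((m + N : ℕ) : ℝ))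
      atTop (nhds 1) := by
  have hg : Tendsto (fun k : ℕ => (k + 1 : ℝ) / (k + 2)) atTop (nhds 1) := by
    have h := ((tendsto_natCast_div_add_atTop (1 : ℝ)).comp (tendsto_add_atTop_nat 1))
    refine h.congr fun k => ?_
    simp only [Function.comp_apply]
    push_cast
    ring
  have h := hg.cesaro.mul (tendsto_natCast_div_add_atTop (N : ℝ))
  rw [mul_one] at h
  refine h.congr' ?_
  filter_upwards [eventually_gt_atTop 0] with m hm
  have h1 : (m : ℝ) ≠ 0 := by positivity
  have h2 : (m : ℝ) + N ≠ 0 := by positivity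
  push_cast
  field_simp

/-- An eventual lower bound for `p_n(α)` improves by any factor smaller than `α`. -/
theorem bmpP_eventually_ge_mul {α β C : ℝ} (hα : 0 < α) (hβ : β < α) (hC : 0 < C)
    (h : ∀ᶠ n in atTop, C ≤ bmpP α n) : ∀ᶠ n in atTop, β * C ≤ bmpP α n := by
  obtain ⟨N, hN⟩ := eventually_atTop.mp h
  have hlim := (tendsto_sum_div_add (N + 1)).const_mul α
  rw [mul_one] at hlim
  rw [← Filter.map_add_atTop_eq_nat (N + 1), eventually_map]
  filter_upwards [hlim.eventually_const_lt hβ] with m hm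
  calc β * C ≤ α * ((∑ k ∈ Finset.range m, (k + 1 : ℝ) / (k + 2)) / ((m + (N + 1) : ℕ) : ℝ)) * C :=
        mul_le_mul_of_nonneg_right hm.le hC.le
    _ = α / (((m + N : ℕ) : ℝ) + 1) * ∑ k ∈ Finset.range m, (k + 1 : ℝ) / (k + 2) * C := by
        rw [← Finset.sum_mul]
        push_cast
        ring
    _ ≤ bmpP α (m + (N + 1)) := by
        rw [← add_assoc, bmpP]
        refine mul_le_mul_of_nonneg_left ?_ (by positivity)
        calc _ ≤ ∑ k ∈ Finset.range m, (k + 1 : ℝ) / (k + 2) * bmpP α (m + N - k) := by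
              refine Finset.sum_le_sum fun k hk => ?_
              have hk' := Finset.mem_range.mp hk
              exact mul_le_mul_of_nonneg_left (hN _ (by omega)) (by positivity)
          _ ≤ _ := by
              refine Finset.sum_le_sum_of_subset_of_nonneg
                (Finset.range_subset_range.mpr (by omega)) fun k _ _ => ?_
              exact mul_nonneg (by positivity) (bmpP_pos hα _).le

theorem bmpP_tendsto_atTop {α : ℝ} (hα : 1 < α) :
    Tendsto (fun n : ℕ => bmpP α n) atTop atTop := by
  obtain ⟨β, hβ1, hβα⟩ := exists_between hα
  have hβ0 : 0 < β := by linarith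
  have hpow : ∀ k : ℕ, ∀ᶠ n in atTop, β ^ k * Real.exp (-1) ≤ bmpP α n := by
    intro k
    induction k with
    | zero =>
      refine Eventually.of_forall fun n => ?_
      rw [pow_zero, one_mul]
      exact ((bmpP_strictAnti one_pos le_rfl).antitone.le_of_tendsto bmpP_one_tendsto n).trans
        (bmpP_one_le hα.le n)
    | succ k ih =>
      filter_upwards [bmpP_eventually_ge_mul (by linarith) hβα (by positivity) ih] with n hn
      rwa [pow_succ', mul_assoc]
  refine tendsto_atTop.mpr fun b => ?_
  obtain ⟨k, hk⟩ := (((tendsto_pow_atTop_atTop_of_one_lt hβ1).atTop_mul_const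
    (Real.exp_pos (-1))).eventually_ge_atTop b).exists
  exact (hpow k).mono fun n hn => hk.trans hn

/-- Monotonicity and limits of `(p_n(α))_{n≥0}`: strictly decreasing for `0 < α ≤ 1`,
increasing for `α ≥ 2`; limit `0` for `0 < α < 1`, `e⁻¹` for `α = 1`, `∞` for `α > 1`. -/
theorem stmt16 (α : ℝ) :
    (0 < α → α ≤ 1 → StrictAnti (fun n : ℕ => bmpP α n)) ∧
    (2 ≤ α → Monotone (fun n : ℕ => bmpP α n)) ∧
    (0 < α → α < 1 → Filter.Tendsto (fun n : ℕ => bmpP α n) Filter.atTop (nhds 0)) ∧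
    (α = 1 → Filter.Tendsto (fun n : ℕ => bmpP α n) Filter.atTop (nhds (Real.exp (-1)))) ∧
    (1 < α → Filter.Tendsto (fun n : ℕ => bmpP α n) Filter.atTop Filter.atTop) := by
  refine ⟨bmpP_strictAnti, bmpP_monotone, bmpP_tendsto_zero, ?_, bmpP_tendsto_atTop⟩
  rintro rfl
  exact bmpP_one_tendsto
end

section
/- For every α > 0, lim_{n→∞} p_{n+1}(α)/p_n(α) = 1 and lim_{n→∞} (p_n(α))^{1/n} = 1. -/
open MeasureTheory Filter Set Asymptotics

/-- Summation by parts applied to the defining recursion. -/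
theorem succ_mul_bmpP_succ (α : ℝ) (n : ℕ) :
    (n + 1) * bmpP α (n + 1) =
      n * bmpP α n +
        α * ∑ k ∈ Finset.range (n + 1), 1 / (((k : ℝ) + 1) * (k + 2)) * bmpP α (n - k) := by
  have key (m : ℕ) : ((m : ℝ) + 1) * bmpP α (m + 1) =
      α * ∑ k ∈ Finset.range (m + 1), (((k : ℝ) + 1) / (k + 2)) * bmpP α (m - k) := by
    rw [bmpP]
    field_simp
  rw [key]
  cases n with
  | zero => simp
  | succ m =>
    rw [Nat.cast_add_one, key, Finset.sum_range_succ', Finset.sum_range_succ' _ (m + 1),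
      ← mul_add, ← add_assoc, ← Finset.sum_add_distrib]
    congr 2
    · refine Finset.sum_congr rfl fun k _ => ?_
      rw [Nat.add_sub_add_right, ← add_mul]
      congr 1
      push_cast
      field_simp
      ring
    · norm_num

theorem monotone_mul_bmpP {α : ℝ} (hα : 0 < α) : Monotone fun n : ℕ => n * bmpP α n := by
  refine monotone_nat_of_le_succ fun n => ?_
  push_cast
  rw [succ_mul_bmpP_succ]
  have : 0 ≤ ∑ k ∈ Finset.range (n + 1), 1 / (((k : ℝ) + 1) * (k + 2)) * bmpP α (n - k) :=
    Finset.sum_nonneg fun k _ => mul_nonneg (by positivity) (bmpP_pos hα _).le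
  nlinarith

theorem sum_one_div_succ_mul_le_one (n : ℕ) :
    ∑ k ∈ Finset.range n, 1 / (((k : ℝ) + 1) * (k + 2)) ≤ 1 := by
  have h : ∑ k ∈ Finset.range n, 1 / (((k : ℝ) + 1) * (k + 2)) = 1 - 1 / ((n : ℝ) + 1) := by
    induction n with
    | zero => simp
    | succ n ih =>
      rw [Finset.sum_range_succ, ih]
      push_cast
      field_simp
      ring
  rw [h]
  have : 0 ≤ 1 / ((n : ℝ) + 1) := by positivity
  linarith

theorem convolution_bmpP_le {α : ℝ} (hα : 0 < α) {n : ℕ} (hn : 1 ≤ n) :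
    ∑ k ∈ Finset.range (n + 1), 1 / (((k : ℝ) + 1) * (k + 2)) * bmpP α (n - k) ≤
      (2 + 2 / α) * bmpP α n := by
  have hp := bmpP_pos hα n
  have hn' : (0 : ℝ) < n := by exact_mod_cast hn
  have hlast : 1 / (((n : ℝ) + 1) * (n + 2)) * bmpP α (n - n) ≤ 2 / α * bmpP α n := by
    have h1 := monotone_mul_bmpP hα hn
    have h2 : bmpP α 1 = α / 2 := by simpa [bmpP] using (div_eq_mul_inv α 2).symm
    simp only [Nat.cast_one, one_mul, h2] at h1
    rw [Nat.sub_self, bmpP, mul_one, div_le_iff₀ (by positivity), div_mul_eq_mul_div,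
      div_mul_eq_mul_div, le_div_iff₀ hα]
    have : 0 ≤ bmpP α n * ((n : ℝ) ^ 2 + 2 * n + 2) := by positivity
    nlinarith
  have hterm : ∀ k ∈ Finset.range n, 1 / (((k : ℝ) + 1) * (k + 2)) * bmpP α (n - k) ≤
      (1 / (((k : ℝ) + 1) * (k + 2)) + 1 / n) * bmpP α n := by
    intro k hk
    have hkn : k < n := Finset.mem_range.mp hk
    obtain ⟨j, rfl⟩ : ∃ j, n = k + (j + 1) := ⟨n - k - 1, by omega⟩
    have h1 := monotone_mul_bmpP hα (Nat.sub_le (k + (j + 1)) k)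
    simp only [Nat.add_sub_cancel_left] at h1 ⊢
    push_cast at h1 hn' ⊢
    have h3 : bmpP α (j + 1) ≤ (k + (j + 1)) / (j + 1) * bmpP α (k + (j + 1)) := by
      rw [div_mul_eq_mul_div, le_div_iff₀ (by positivity)]
      linarith
    refine (mul_le_mul_of_nonneg_left h3 (by positivity)).trans ?_
    rw [← mul_assoc]
    refine mul_le_mul_of_nonneg_right ?_ hp.le
    rw [div_add_div _ _ (by positivity) (by positivity), div_mul_div_comm,
      div_le_div_iff₀ (by positivity) (by positivity), ← sub_nonneg]
    ring_nf
    positivity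
  rw [Finset.sum_range_succ, add_mul 2 (2 / α)]
  refine add_le_add ((Finset.sum_le_sum hterm).trans ?_) hlast
  rw [← Finset.sum_mul, Finset.sum_add_distrib]
  refine mul_le_mul_of_nonneg_right ?_ hp.le
  have h1 := sum_one_div_succ_mul_le_one n
  have h2 : ∑ _k ∈ Finset.range n, 1 / (n : ℝ) = 1 := by
    simp [hn'.ne']
  linarith

theorem tendsto_bmpP_succ_div {α : ℝ} (hα : 0 < α) :
    Tendsto (fun n : ℕ => bmpP α (n + 1) / bmpP α n) atTop (nhds 1) := by
  have h0 : Tendsto (fun n : ℕ => (n : ℝ) / (n + 1)) atTop (nhds 1) :=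
    tendsto_natCast_div_add_atTop 1
  have h1 : Tendsto (fun n : ℕ => (n : ℝ) / (n + 1) + α * (2 + 2 / α) * (1 / ((n : ℝ) + 1)))
      atTop (nhds 1) := by
    simpa using h0.add
      ((tendsto_one_div_add_atTop_nhds_zero_nat (𝕜 := ℝ)).const_mul (α * (2 + 2 / α)))
  refine tendsto_of_tendsto_of_tendsto_of_le_of_le' h0 h1 (Eventually.of_forall fun n => ?_) ?_
  · have h := monotone_mul_bmpP hα n.le_succ
    push_cast at h
    rw [div_le_div_iff₀ (by positivity) (bmpP_pos hα n)]
    simp only [Nat.succ_eq_add_one] at h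
    linarith
  · filter_upwards [eventually_ge_atTop 1] with n hn
    have h := mul_le_mul_of_nonneg_left (convolution_bmpP_le hα hn) hα.le
    have hr := succ_mul_bmpP_succ α n
    rw [mul_one_div, ← add_div, div_le_div_iff₀ (bmpP_pos hα n) (by positivity)]
    linarith

/-- If the ratios of consecutive terms of a positive sequence tend to `1`, so do the `n`-th
roots. -/
theorem tendsto_rpow_one_div_of_tendsto_succ_div {u : ℕ → ℝ} (hu : ∀ n, 0 < u n)
    (h : Tendsto (fun n : ℕ => u (n + 1) / u n) atTop (nhds 1)) :
    Tendsto (fun n : ℕ => u n ^ ((1 : ℝ) / n)) atTop (nhds 1) := by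
  have hlog : Tendsto (fun n : ℕ => Real.log (u (n + 1)) - Real.log (u n)) atTop (nhds 0) := by
    have := h.log one_ne_zero
    rw [Real.log_one] at this
    exact this.congr fun n => Real.log_div (hu _).ne' (hu _).ne'
  have hces := hlog.cesaro
  simp only [Finset.sum_range_sub (fun n => Real.log (u n))] at hces
  have hzero : Tendsto (fun n : ℕ => (n : ℝ)⁻¹ * Real.log (u 0)) atTop (nhds 0) := by
    simpa using (tendsto_inv_atTop_nhds_zero_nat (𝕜 := ℝ)).mul_const (Real.log (u 0))
  have hexp := (hces.add hzero).rexp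
  rw [add_zero, Real.exp_zero] at hexp
  refine hexp.congr fun n => ?_
  rw [Real.rpow_def_of_pos (hu n)]
  ring_nf

/-- For `α > 0`, `p_{n+1}(α)/p_n(α) → 1` and `p_n(α)^{1/n} → 1` as `n → ∞`. -/
theorem stmt17 (α : ℝ) (hα : 0 < α) :
    Filter.Tendsto (fun n : ℕ => bmpP α (n + 1) / bmpP α n) Filter.atTop (nhds 1) ∧
    Filter.Tendsto (fun n : ℕ => bmpP α n ^ ((1 : ℝ) / n)) Filter.atTop (nhds 1) := by
  exact ⟨tendsto_bmpP_succ_div hα,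
    tendsto_rpow_one_div_of_tendsto_succ_div (bmpP_pos hα) (tendsto_bmpP_succ_div hα)⟩
end
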